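/- arXiv:1404.0087 — 3 statements merged into one kernel-verified Lean document; each statement's English description precedes it below -/
import Mathlib

section
/- The MTL-model checking problem for parametric timed automata — given a parametric timed automaton A and an MTL formula φ, decide whether there exists a parameter valuation ν such that every timed word in L_ν(A) satisfies φ — is undecidable, even when restricted to inputs where A is deterministic and uses only one clock and one parameter. -/
open scoped NNRat

noncomputable section

/-! ### Parametric timed automata -/

inductive Cmp : Type
  | lt | le | eq | ge | gt
  deriving DecidableEq

def Cmp.holds : Cmp → ℝ → ℝ → Prop
  | .lt, a, b => a < b
  | .le, a, b => a ≤ b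
  | .eq, a, b => a = b
  | .ge, a, b => b ≤ a
  | .gt, a, b => b < a

/-- An atomic clock constraint `x ∼ c` with `c ∈ ℕ ∪ P`. -/
structure ClockAtom (X P : Type) where
  clock : X
  cmp : Cmp
  bound : ℕ ⊕ P

/-- A clock constraint: a conjunction (list) of atomic constraints. -/
abbrev ClockConstraint (X P : Type) := List (ClockAtom X P)

def ClockAtom.Sat {X P : Type} (ν : X → ℝ) (π : P → ℚ≥0) (c : ClockAtom X P) : Prop :=
  c.cmp.holds (ν c.clock)
    (match c.bound with
      | Sum.inl n => (n : ℝ)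
      | Sum.inr p => ((π p : ℚ≥0) : ℝ))

def ClockConstraint.Sat {X P : Type} (ν : X → ℝ) (π : P → ℚ≥0)
    (φ : ClockConstraint X P) : Prop :=
  ∀ c ∈ φ, c.Sat ν π

/-- A parametric timed automaton over alphabet `A`, clocks `X`, parameters `P`,
locations `Loc`. -/
structure PTA (A X P Loc : Type) where
  init : Set Loc
  edges : Set (Loc × A × ClockConstraint X P × Set X × Loc)
  final : Set Loc

/-- `PTA.Run M π l ν t w`: from global state `(l, ν)` at absolute time `t`, the automaton
can read the (absolutely timestamped) timed word `w` and end in a final location. -/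
inductive PTA.Run {A X P Loc : Type} (M : PTA A X P Loc) (π : P → ℚ≥0) :
    Loc → (X → ℝ) → ℝ → List (A × ℝ) → Prop
  | nil (l : Loc) (ν : X → ℝ) (t : ℝ) : l ∈ M.final → PTA.Run M π l ν t []
  | cons {l : Loc} {ν : X → ℝ} {t : ℝ} {a : A} {t' : ℝ} {l' : Loc} {ν' : X → ℝ}
      {w : List (A × ℝ)} (φ : ClockConstraint X P) (lam : Set X) :
      t ≤ t' →
      (l, a, φ, lam, l') ∈ M.edges →
      ClockConstraint.Sat (fun x => ν x + (t' - t)) π φ →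
      (∀ x, (x ∈ lam → ν' x = 0) ∧ (x ∉ lam → ν' x = ν x + (t' - t))) →
      PTA.Run M π l' ν' t' w →
      PTA.Run M π l ν t ((a, t') :: w)

/-- The timed language accepted by `M` under parameter valuation `π`. -/
def PTA.Lang {A X P Loc : Type} (M : PTA A X P Loc) (π : P → ℚ≥0) :
    Set (List (A × ℝ)) :=
  { w | w ≠ [] ∧ ∃ l ∈ M.init, PTA.Run M π l (fun _ => 0) 0 w }

def PTA.Deterministic {A X P Loc : Type} (M : PTA A X P Loc) : Prop :=
  (∃ l, M.init = {l}) ∧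
  ∀ e₁ ∈ M.edges, ∀ e₂ ∈ M.edges, e₁ ≠ e₂ → e₁.1 = e₂.1 → e₁.2.1 = e₂.2.1 →
    ∀ (ν : X → ℝ) (π : P → ℚ≥0),
      ¬ (ClockConstraint.Sat ν π e₁.2.2.1 ∧ ClockConstraint.Sat ν π e₂.2.2.1)

/-- A (finite, nonempty) timed word with non-decreasing, non-negative timestamps. -/
def IsTimedWord {A : Type} (w : List (A × ℝ)) : Prop :=
  w ≠ [] ∧ (∀ e ∈ w, 0 ≤ e.2) ∧ List.Chain' (fun e f : A × ℝ => e.2 ≤ f.2) w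

/-! ### Metric temporal logic -/

/-- An interval of `ℝ≥0` with endpoints in `ℕ ∪ {∞}` (`hi = none` means `∞`). -/
structure MTLInterval where
  lo : ℕ
  hi : Option ℕ
  loStrict : Bool
  hiStrict : Bool

def MTLInterval.Mem (I : MTLInterval) (t : ℝ) : Prop :=
  (if I.loStrict then (I.lo : ℝ) < t else (I.lo : ℝ) ≤ t) ∧
  (match I.hi with
    | none => True
    | some b => if I.hiStrict then t < (b : ℝ) else t ≤ (b : ℝ))

/-- `[0, ∞)`, i.e. the full time domain `ℝ≥0`. -/
def MTLInterval.full : MTLInterval := ⟨0, none, false, false⟩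
/-- `(0, ∞)`. -/
def MTLInterval.pos : MTLInterval := ⟨0, none, true, false⟩
/-- `[n, n] = {n}`. -/
def MTLInterval.exactly (n : ℕ) : MTLInterval := ⟨n, some n, false, false⟩
/-- `[0, n)`, i.e. `< n`. -/
def MTLInterval.ltI (n : ℕ) : MTLInterval := ⟨0, some n, false, true⟩
/-- `(a, b)`. -/
def MTLInterval.ooI (a b : ℕ) : MTLInterval := ⟨a, some b, true, true⟩
/-- `[a, b)`. -/
def MTLInterval.coI (a b : ℕ) : MTLInterval := ⟨a, some b, false, true⟩

/-- MTL formulae over atomic propositions (alphabet letters) `A`. -/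
inductive MTL (A : Type) : Type
  | atom : A → MTL A
  | not : MTL A → MTL A
  | and : MTL A → MTL A → MTL A
  | untl : MTL A → MTL A → MTLInterval → MTL A

/-- Timestamp of the `i`-th event of `w` (junk value `0` out of range). -/
def tstamp {A : Type} (w : List (A × ℝ)) (i : ℕ) : ℝ :=
  ((w[i]?).map Prod.snd).getD 0

/-- The pointwise satisfaction relation for MTL over finite timed words
(positions are 0-based). -/
def MTL.Sat {A : Type} (w : List (A × ℝ)) : MTL A → ℕ → Prop
  | .atom a, i => (w[i]?).map Prod.fst = some a
  | .not φ, i => ¬ MTL.Sat w φ i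
  | .and φ ψ, i => MTL.Sat w φ i ∧ MTL.Sat w ψ i
  | .untl φ ψ I, i => ∃ j, i < j ∧ j < w.length ∧ MTL.Sat w ψ j ∧
      I.Mem (tstamp w j - tstamp w i) ∧ ∀ k, i < k → k < j → MTL.Sat w φ k

namespace MTL
variable {A : Type}
def or (φ ψ : MTL A) : MTL A := .not (.and (.not φ) (.not ψ))
def imp (φ ψ : MTL A) : MTL A := or (.not φ) ψ
def tt [Inhabited A] : MTL A := or (.atom default) (.not (.atom default))
def ff [Inhabited A] : MTL A := .not tt
def X [Inhabited A] (I : MTLInterval) (φ : MTL A) : MTL A := .untl ff φ I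
def F [Inhabited A] (I : MTLInterval) (φ : MTL A) : MTL A := .untl tt φ I
def G [Inhabited A] (I : MTLInterval) (φ : MTL A) : MTL A := .not (F I (.not φ))
def bigOr [Inhabited A] (l : List (MTL A)) : MTL A := l.foldr or ff
def bigAnd [Inhabited A] (l : List (MTL A)) : MTL A := l.foldr .and tt
end MTL


/-! ### Concrete encodings for the undecidability statement

We represent parametric timed automata with one clock and one parameter, over the
alphabet `ℕ` and with locations in `ℕ`, by concrete codes, and MTL formulae over `ℕ`
by natural-number codes, so that the model checking problem becomes a predicate on an
effectively encodable (`Primcodable`) type and (un)decidability can be phrased via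
`Computable`. -/

/-- A code for an atomic constraint on the unique clock: a comparison operator
(`Fin 5`) and a bound (`none` codes the unique parameter `p`, `some k` the constant
`k ∈ ℕ`). -/
abbrev AtomCode := Fin 5 × Option ℕ

/-- A code for an edge: source location, input letter, guard, reset flag for the unique
clock, target location. -/
abbrev EdgeCode := ℕ × ℕ × List AtomCode × Bool × ℕ

/-- A code for a parametric timed automaton with one clock and one parameter:
initial location, list of edges, list of final locations. -/
abbrev PTACode := ℕ × List EdgeCode × List ℕ

def cmpOfFin : Fin 5 → Cmp
  | 0 => Cmp.lt
  | 1 => Cmp.le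
  | 2 => Cmp.eq
  | 3 => Cmp.ge
  | 4 => Cmp.gt

def interpGuard (g : List AtomCode) : ClockConstraint Unit Unit :=
  g.map fun c =>
    { clock := (), cmp := cmpOfFin c.1,
      bound := match c.2 with
        | none => Sum.inr ()
        | some k => Sum.inl k }

def interpEdge (e : EdgeCode) : ℕ × ℕ × ClockConstraint Unit Unit × Set Unit × ℕ :=
  (e.1, e.2.1, interpGuard e.2.2.1,
    (if e.2.2.2.1 then Set.univ else (∅ : Set Unit)), e.2.2.2.2)

/-- The parametric timed automaton (with one clock and one parameter) denoted by a code. -/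
def toPTA (A : PTACode) : PTA ℕ Unit Unit ℕ where
  init := {A.1}
  edges := { e | ∃ e0 ∈ A.2.1, e = interpEdge e0 }
  final := { l | l ∈ A.2.2 }

def decodeInterval (q : ℕ) : MTLInterval where
  lo := q.unpair.1.unpair.1
  hi := match q.unpair.1.unpair.2 with
    | 0 => none
    | Nat.succ k => some k
  loStrict := q.unpair.2.unpair.1 % 2 == 1
  hiStrict := q.unpair.2.unpair.2 % 2 == 1

/-- A surjective decoding of natural numbers into MTL formulae over the alphabet `ℕ`. -/
def decodeMTL : ℕ → MTL ℕ
  | 0 => MTL.atom 0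
  | (n + 1) =>
    match (n + 1) % 4 with
    | 0 => MTL.atom ((n + 1) / 4)
    | 1 => MTL.not (decodeMTL ((n + 1) / 4))
    | 2 => MTL.and (decodeMTL ((n + 1) / 4).unpair.1) (decodeMTL ((n + 1) / 4).unpair.2)
    | _ => MTL.untl (decodeMTL ((n + 1) / 4).unpair.1.unpair.1)
        (decodeMTL ((n + 1) / 4).unpair.1.unpair.2)
        (decodeInterval ((n + 1) / 4).unpair.2)
decreasing_by
  all_goals
    first
      | exact Nat.div_lt_self (Nat.succ_pos _) (by norm_num)
      | exact lt_of_le_of_lt (Nat.unpair_left_le _)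
          (Nat.div_lt_self (Nat.succ_pos _) (by norm_num))
      | exact lt_of_le_of_lt (Nat.unpair_right_le _)
          (Nat.div_lt_self (Nat.succ_pos _) (by norm_num))
      | exact lt_of_le_of_lt (le_trans (Nat.unpair_left_le _) (Nat.unpair_left_le _))
          (Nat.div_lt_self (Nat.succ_pos _) (by norm_num))
      | exact lt_of_le_of_lt (le_trans (Nat.unpair_right_le _) (Nat.unpair_left_le _))
          (Nat.div_lt_self (Nat.succ_pos _) (by norm_num))

namespace PtaUndec

open Turing

/-- The halting set, as a predicate on natural numbers. -/
theorem exists_halting_nat : ∃ g : ℕ →. ℕ, Partrec g ∧ ¬ ComputablePred fun m : ℕ => (g (2 ^ m)).Dom := by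
  let f : ℕ →. ℕ := fun n => Nat.Partrec.Code.eval (Denumerable.ofNat Nat.Partrec.Code n) 0
  have hf : Partrec f :=
    Nat.Partrec.Code.eval_part.comp (Computable.ofNat Nat.Partrec.Code) (Computable.const 0)
  have hpow : Primrec₂ (fun a b : ℕ => a ^ b) := Primrec₂.unpaired'.1 Nat.Primrec.pow
  have hp : Partrec₂ (fun (x : ℕ) => (fun m => Part.some (decide (2 ^ m = x)) : ℕ →. Bool)) := by
    have h1 : PrimrecRel (fun x m : ℕ => 2 ^ m = x) :=
      Primrec.eq.comp (hpow.comp (Primrec.const 2) Primrec.snd) Primrec.fst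
    exact Computable.partrec (h1.decide.to_comp)
  let g : ℕ →. ℕ := fun x => (Nat.rfind (fun m => Part.some (decide (2 ^ m = x)))).bind f
  refine ⟨g, (Partrec.rfind hp).bind (hf.comp Computable.snd), ?_⟩
  have hg : ∀ m, g (2 ^ m) = f m := by
    intro m
    have : Nat.rfind (fun k => Part.some (decide (2 ^ k = 2 ^ m))) = Part.some m := by
      rw [Part.eq_some_iff]
      refine Nat.mem_rfind.2 ⟨?_, ?_⟩
      · simp
      · intro k hk
        have : ¬ (2 ^ k = 2 ^ m) := fun h => hk.ne (Nat.pow_right_injective (le_refl 2) h)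
        simp [hk.ne]
    simp only [g, this]
    exact Part.bind_some m f
  simp only [hg]
  intro hc
  apply ComputablePred.halting_problem 0
  obtain ⟨d, hd, hfd⟩ := ComputablePred.computable_iff.1 hc
  refine ComputablePred.computable_iff.2
    ⟨fun c : Nat.Partrec.Code => d (Encodable.encode c), hd.comp Computable.encode, ?_⟩
  funext c
  have := congrFun hfd (Encodable.encode c)
  simpa [f] using this

theorem trNat_two_pow (m : ℕ) :
    PartrecToTM2.trNat (2 ^ m) = List.replicate m PartrecToTM2.Γ'.bit0 ++ [PartrecToTM2.Γ'.bit1] := by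
  induction m with
  | zero => simp [PartrecToTM2.trNat]; rfl
  | succ m ih =>
    rw [PartrecToTM2.trNat] at ih ⊢
    have h : ((2 ^ (m + 1) : ℕ) : Num) = Num.bit0 ((2 ^ m : ℕ) : Num) := by
      rw [← Num.bit0_of_bit0, pow_succ, mul_two, Nat.cast_add]
    rw [h, List.replicate_succ, List.cons_append, ← ih]
    cases h2 : ((2 ^ m : ℕ) : Num) with
    | zero => rw [h2] at ih; simp [PartrecToTM2.trNum] at ih
    | pos p => rfl

instance instFintypeK : Fintype PartrecToTM2.K' :=
  ⟨{.main, .rev, .aux, .stack}, by rintro ⟨⟩ <;> simp⟩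

theorem exists_machine : ∃ (Γ Λ : Type) (_ : Inhabited Γ) (_ : Inhabited Λ) (_ : Fintype Γ)
    (M : TM0.Machine Γ Λ) (S : Finset Λ) (A B C : Γ), TM0.Supports M (S : Set Λ) ∧
    ¬ ComputablePred fun m : ℕ =>
      (StateTransition.eval (TM0.step M) (TM0.init (A :: B :: List.replicate m C))).Dom := by
  obtain ⟨g, hg, hgc⟩ := exists_halting_nat
  obtain ⟨c, hc⟩ := ToPartrec.Code.exists_code (Nat.Partrec'.part_iff₁.2 hg)
  let k := PartrecToTM2.Cont'.halt
  let _ : Inhabited PartrecToTM2.Λ' := ⟨PartrecToTM2.trNormal c k⟩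
  have s2 : TM2.Supports PartrecToTM2.tr (PartrecToTM2.codeSupp c k) := PartrecToTM2.tr_supports c k
  have s1 := TM2to1.tr_supports _ s2
  have s0 := TM1to0.tr_supports _ s1
  let G : PartrecToTM2.Γ' → TM2to1.Γ' PartrecToTM2.K' (fun _ => PartrecToTM2.Γ') := fun a =>
    (false, Function.update (fun _ => none) PartrecToTM2.K'.main (some a))
  refine ⟨_, _, inferInstance, inferInstance, inferInstance, _, _,
    (true, (G .cons).2), G .bit1, G .bit0, s0, ?_⟩
  intro h
  apply hgc
  convert h using 2 with m
  have e1 := congrArg Part.Dom (TM1to0.tr_eval (TM2to1.tr PartrecToTM2.tr)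
    (TM2to1.trInit PartrecToTM2.K'.main (PartrecToTM2.trList [2 ^ m])))
  have e2 := TM2to1.tr_eval_dom PartrecToTM2.tr PartrecToTM2.K'.main (PartrecToTM2.trList [2 ^ m])
  rw [← e1] at e2
  have e3 : (TM2.eval PartrecToTM2.tr PartrecToTM2.K'.main (PartrecToTM2.trList [2 ^ m])).Dom ↔
      (StateTransition.eval (TM2.step PartrecToTM2.tr) (PartrecToTM2.init c [2 ^ m])).Dom := by
    have : (TM2.init PartrecToTM2.K'.main (PartrecToTM2.trList [2 ^ m])) = 
       PartrecToTM2.init c [2 ^ m] := by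
      unfold TM2.init PartrecToTM2.init
      congr 1
      funext k
      cases k <;> rfl
    rw [← this]; rfl
  have e4 := congrArg Part.Dom (PartrecToTM2.tr_eval c [2 ^ m])
  have e5 := congrArg Part.Dom (hc ⟨[2 ^ m], rfl⟩)
  have e6 : TM2to1.trInit (Γ := fun _ => PartrecToTM2.Γ') PartrecToTM2.K'.main
      (PartrecToTM2.trList [2 ^ m]) =
    ((true, (G .cons).2) :: G .bit1 :: List.replicate m (G .bit0)) := by
    have hr : (PartrecToTM2.trList [2 ^ m]).reverse = PartrecToTM2.Γ'.cons ::
        PartrecToTM2.Γ'.bit1 :: List.replicate m PartrecToTM2.Γ'.bit0 := by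
      simp [PartrecToTM2.trList, trNat_two_pow]
    unfold TM2to1.trInit
    rw [hr]
    show _ :: G .bit1 :: List.map G _ = _
    rw [List.map_replicate]
    rfl
  rw [e6] at e2
  rw [e3, e4] at e2
  refine Iff.trans ?_ (Iff.symm e2)
  have e7 : (PartrecToTM2.halt <$> c.eval [2 ^ m]).Dom = (c.eval [2 ^ m]).Dom := rfl
  rw [e7]
  rw [show (c.eval [2 ^ m]).Dom = _ from e5]
  rfl

end PtaUndec
namespace PtaUndec

open Turing

/-- A cell of the space-time diagram: `f` marks the first column, `g` the diagonal, `q` is the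
machine state, `h` the scanned symbol, `a` and `b` the symbols at distance `i` to the right and
to the left of the head. -/
@[ext]
structure Cell (Q Γ : Type) where
  f : Bool
  g : Bool
  q : Q
  h : Γ
  a : Γ
  b : Γ

noncomputable instance instFintypeCell {Q Γ : Type} [Fintype Q] [Fintype Γ] : Fintype (Cell Q Γ) :=
  Fintype.ofInjective (fun c : Cell Q Γ => (c.f, c.g, c.q, c.h, c.a, c.b)) (by
    intro c d h
    simp only [Prod.mk.injEq] at h
    ext <;> simp [h])

variable {Γ Λ : Type} [Inhabited Γ] [Inhabited Λ]

/-- Effect of a statement on the neighbouring cells. -/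
def StmtRel {Q : Type} (s : TM0.Stmt Γ) (x y z u : Cell Q Γ) : Prop :=
  match s with
  | .write c => (x.f = true → z.a = c) ∧ (x.f = false → z.a = x.a ∧ z.b = x.b)
  | .move Dir.right => y.f = false → z.a = y.a ∧ u.b = x.b
  | .move Dir.left => y.f = false → u.a = x.a ∧ z.b = y.b

/-- The local relation between the cells at positions `t`, `t+1`, `t+n`, `t+n+1`. -/
def LocRel (M : TM0.Machine Γ Λ) (S : Finset Λ) (x y z u : Cell S Γ) : Prop :=
  z.f = x.f ∧ (x.f = true → z.g = false) ∧ (y.f = false → u.g = x.g) ∧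
  (y.f = false → y.q = x.q ∧ y.h = x.h) ∧
  (z.f = true → z.a = z.h ∧ z.b = z.h) ∧
  ∃ q' s, M x.q.1 x.h = some (q', s) ∧ z.q.1 = q' ∧ StmtRel s x y z u

/-- Total step function (stuttering at halting configurations). -/
def stepD (M : TM0.Machine Γ Λ) (c : TM0.Cfg Γ Λ) : TM0.Cfg Γ Λ := (TM0.step M c).getD c

def conf (M : TM0.Machine Γ Λ) (c : TM0.Cfg Γ Λ) (r : ℕ) : TM0.Cfg Γ Λ := (stepD M)^[r] c

theorem conf_succ (M : TM0.Machine Γ Λ) (c : TM0.Cfg Γ Λ) (r : ℕ) :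
    conf M c (r + 1) = stepD M (conf M c r) := by
  simp [conf, Function.iterate_succ_apply']

theorem dom_iff (M : TM0.Machine Γ Λ) (c : TM0.Cfg Γ Λ) :
    (StateTransition.eval (TM0.step M) c).Dom ↔ ∃ K, TM0.step M (conf M c K) = none := by
  rw [Part.dom_iff_mem]
  simp only [StateTransition.mem_eval]
  constructor
  · rintro ⟨b, hr, hb⟩
    have : ∃ k, conf M c k = b := by
      clear hb
      induction hr with
      | refl => exact ⟨0, rfl⟩
      | tail _ h ih =>
        obtain ⟨k, rfl⟩ := ih
        refine ⟨k + 1, ?_⟩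
        rw [conf_succ, stepD, Option.mem_def.1 h]; rfl
    obtain ⟨k, rfl⟩ := this
    exact ⟨k, hb⟩
  · rintro ⟨K, hK⟩
    refine ⟨_, ?_, hK⟩
    clear hK
    induction K with
    | zero => exact Relation.ReflTransGen.refl
    | succ k ih =>
      rw [conf_succ, stepD]
      cases h : TM0.step M (conf M c k) with
      | none => exact ih
      | some d => exact ih.tail h

/-- Effect of a statement on the tape. -/
def act (s : TM0.Stmt Γ) (T : Tape Γ) : Tape Γ :=
  match s with
  | .move d => T.move d
  | .write a => T.write a

theorem step_eq (M : TM0.Machine Γ Λ) (c : TM0.Cfg Γ Λ) {q' : Λ} {s : TM0.Stmt Γ}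
    (h : M c.q (c.Tape.nth 0) = some (q', s)) :
    TM0.step M c = some ⟨q', act s c.Tape⟩ := by
  obtain ⟨q, T⟩ := c
  rw [Tape.nth_zero] at h
  simp only [TM0.step]
  dsimp only at h
  rw [h]
  cases s <;> rfl

/-- The cell `c` is the correct cell in row `r`, column `i`. -/
def DataOk {S : Finset Λ} (k : TM0.Cfg Γ Λ) (i : ℕ) (c : Cell S Γ) : Prop :=
  c.q.1 = k.q ∧ c.h = k.Tape.nth 0 ∧ c.a = k.Tape.nth i ∧ c.b = k.Tape.nth (-i)

theorem sound (M : TM0.Machine Γ Λ) (S : Finset Λ) (c0 : TM0.Cfg Γ Λ) (W : ℕ → Cell S Γ)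
    (n K len : ℕ) (hn : K + 2 ≤ n) (hK : TM0.step M (conf M c0 K) = none)
    (hR : ∀ t, t + n + 1 < len → LocRel M S (W t) (W (t + 1)) (W (t + n)) (W (t + n + 1)))
    (h0 : ∀ i < n, DataOk c0 i (W i) ∧ (W i).f = decide (i = 0) ∧ (W i).g = decide (i = 0))
    (hF : ∃ t, t + 2 < len ∧ (W t).g = true ∧ (W (t + 1)).f = true) : False := by
  have hflags : ∀ r i, i < n → r * n + i + 1 < len →
      (W (r * n + i)).f = decide (i = 0) ∧ (W (r * n + i)).g = decide (i = r) := by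
    intro r
    induction r with
    | zero => intro i hi _; simpa using (h0 i hi).2
    | succ r ih =>
      intro i hi hl
      have e : (r + 1) * n + i = r * n + i + n := by ring
      rw [e] at hl ⊢
      have h1 := hR (r * n + i) hl
      have hf : (W (r * n + i + n)).f = decide (i = 0) := by
        rw [h1.1]; exact (ih i hi (by omega)).1
      refine ⟨hf, ?_⟩
      rcases i with _ | i
      · have := h1.2.1 (by rw [(ih 0 hi (by omega)).1]; simp)
        rw [this]; simp
      · have h2 := hR (r * n + i) (by omega)
        have h3 := h2.2.2.1 (by
          have := (ih (i + 1) hi (by omega)).1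
          rw [← add_assoc] at this
          rw [this]; simp)
        have e2 : r * n + (i + 1) + n = r * n + i + n + 1 := by ring
        rw [e2, h3, (ih i (by omega) (by omega)).2]
        simp
  have hlen : n * n + 1 < len := by
    obtain ⟨t, ht, hg, hf⟩ := hF
    have hn0 : 0 < n := by omega
    have hm := Nat.mod_lt t hn0
    have hd : t / n * n + t % n = t := Nat.div_add_mod' t n
    have hG := (hflags (t / n) (t % n) hm (by omega)).2
    rw [hd, hg] at hG
    have hG' : t % n = t / n := by simpa using hG.symm
    by_cases h : t % n + 1 < n
    · have := (hflags (t / n) (t % n + 1) h (by omega)).1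
      rw [← add_assoc, hd, hf] at this
      simp at this
    · have h1 : t % n = n - 1 := by omega
      rw [← hG', h1] at hd
      obtain ⟨k, rfl⟩ : ∃ k, n = k + 1 := ⟨n - 1, by omega⟩
      simp only [Nat.add_sub_cancel] at hd
      nlinarith
  have hbase : ∀ r i, r ≤ K → i < n → r * n + i + n + 1 < len := by
    intro r i hr hi
    have : r * n ≤ K * n := Nat.mul_le_mul_right n hr
    have h2 : (K + 2) * n ≤ n * n := Nat.mul_le_mul_right n hn
    nlinarith
  have hdata : ∀ r, r ≤ K → ∀ i, i + r < n → DataOk (conf M c0 r) i (W (r * n + i)) := by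
    intro r
    induction r with
    | zero => intro _ i hi; simpa [conf] using (h0 i hi).1
    | succ r ih =>
      intro hr
      specialize ih (by omega)
      -- local relation with flags in row `r`
      have hrel : ∀ i, i + r + 1 < n → ∃ q' s, M (conf M c0 r).q ((conf M c0 r).Tape.nth 0) =
          some (q', s) ∧ (W (r * n + i + n)).q.1 = q' ∧
          StmtRel s (W (r * n + i)) (W (r * n + i + 1)) (W (r * n + i + n))
            (W (r * n + i + n + 1)) := by
        intro i hi
        obtain ⟨q', s, h1, h2, h3⟩ := (hR (r * n + i) (hbase r i (by omega) (by omega))).2.2.2.2.2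
        have d := ih i (by omega)
        rw [d.1, d.2.1] at h1
        exact ⟨q', s, h1, h2, h3⟩
      obtain ⟨q', s, hM, -, -⟩ := hrel 0 (by omega)
      have hst := step_eq M _ hM
      have hc : conf M c0 (r + 1) = ⟨q', act s (conf M c0 r).Tape⟩ := by
        rw [conf_succ, stepD, hst]; exact Option.getD_some
      have hrel' : ∀ i, i + r + 1 < n → (W (r * n + i + n)).q.1 = q' ∧
          StmtRel s (W (r * n + i)) (W (r * n + i + 1)) (W (r * n + i + n))
            (W (r * n + i + n + 1)) := by
        intro i hi
        obtain ⟨q1, s1, h1, h2, h3⟩ := hrel i hi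
        rw [hM] at h1
        simp only [Option.some.injEq, Prod.mk.injEq] at h1
        obtain ⟨rfl, rfl⟩ := h1
        exact ⟨h2, h3⟩
      have hfl : ∀ i, i < n → (W (r * n + i)).f = decide (i = 0) := fun i hi =>
        (hflags r i hi (by have := hbase r i (by omega) hi; omega)).1
      have hfl' : ∀ i, i < n → (W (r * n + i + n)).f = decide (i = 0) := fun i hi => by
        have := (hflags (r + 1) i hi (by
          have := hbase (r + 1) i (by omega) hi; omega)).1
        rwa [show (r + 1) * n + i = r * n + i + n by ring] at this
      have hfirst : (W (r * n + 0 + n)).a = (W (r * n + 0 + n)).h ∧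
          (W (r * n + 0 + n)).b = (W (r * n + 0 + n)).h :=
        (hR (r * n + 0) (hbase r 0 (by omega) (by omega))).2.2.2.2.1
          (by rw [hfl' 0 (by omega)]; simp)
      -- symbols
      have hsym : ∀ i, i + (r + 1) < n →
          (W (r * n + i + n)).a = (conf M c0 (r + 1)).Tape.nth i ∧
          (W (r * n + i + n)).b = (conf M c0 (r + 1)).Tape.nth (-i) := by
        intro i hi
        have hx := hrel' i (by omega)
        have hy := hfl (i + 1) (by omega)
        rw [← add_assoc] at hy
        have hyf : (W (r * n + i + 1)).f = false := by rw [hy]; simp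
        have dx := ih i (by omega)
        have dy := ih (i + 1) (by omega)
        rw [← add_assoc] at dy
        rw [hc]
        dsimp only
        rcases s with d | c
        · rcases d with _ | _
          · change _ = ((conf M c0 r).Tape.move Dir.left).nth i ∧
              _ = ((conf M c0 r).Tape.move Dir.left).nth (-i)
            have hx2 := hx.2 hyf
            have hb : (W (r * n + i + n)).b =
                ((conf M c0 r).Tape.move Dir.left).nth (-i) := by
              rw [hx2.2, dy.2.2.2, Tape.move_left_nth]; congr 1; push_cast; ring
            refine ⟨?_, hb⟩
            rcases i with _ | i
            · rw [hfirst.1, ← hfirst.2, hb]; simp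
            · have hz := (hrel' i (by omega)).2
              have hzf := hfl (i + 1) (by omega)
              rw [← add_assoc] at hzf
              have := (hz (by rw [hzf]; simp)).1
              rw [show r * n + (i + 1) + n = r * n + i + n + 1 by ring, this,
                (ih i (by omega)).2.2.1, Tape.move_left_nth]
              congr 1; push_cast; ring
          · change _ = ((conf M c0 r).Tape.move Dir.right).nth i ∧
              _ = ((conf M c0 r).Tape.move Dir.right).nth (-i)
            have hx2 := hx.2 hyf
            have ha : (W (r * n + i + n)).a =
                ((conf M c0 r).Tape.move Dir.right).nth i := by
              rw [hx2.1, dy.2.2.1, Tape.move_right_nth]; congr 1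
            refine ⟨ha, ?_⟩
            rcases i with _ | i
            · rw [hfirst.2, ← hfirst.1, ha]; simp
            · have hz := (hrel' i (by omega)).2
              have hzf := hfl (i + 1) (by omega)
              rw [← add_assoc] at hzf
              have := (hz (by rw [hzf]; simp)).2
              rw [show r * n + (i + 1) + n = r * n + i + n + 1 by ring, this,
                (ih i (by omega)).2.2.2, Tape.move_right_nth]
              congr 1; push_cast; ring
        · simp only [act, Tape.write_nth]
          rcases i with _ | i
          · have := hx.2.1 (by rw [hfl 0 (by omega)]; simp)
            rw [hfirst.2, ← hfirst.1, this]; simp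
          · have := hx.2.2 (by rw [hfl (i + 1) (by omega)]; simp)
            rw [this.1, this.2, dx.2.2.1, dx.2.2.2]
            have h1 : ((i + 1 : ℕ) : ℤ) ≠ 0 := by omega
            have h2 : -((i + 1 : ℕ) : ℤ) ≠ 0 := by omega
            rw [if_neg h1, if_neg h2]; simp
      have hh : ∀ i, i + (r + 1) < n →
          (W (r * n + i + n)).h = (conf M c0 (r + 1)).Tape.nth 0 := by
        intro i
        induction i with
        | zero => intro hi; rw [← hfirst.1, (hsym 0 hi).1]; simp
        | succ i ihi =>
          intro hi
          have hb := hbase (r + 1) i hr (by omega)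
          have h1 := hR ((r + 1) * n + i) hb
          rw [show (r + 1) * n + i = r * n + i + n by ring] at h1
          have := hfl' (i + 1) (by omega)
          rw [show r * n + (i + 1) + n = r * n + i + n + 1 by ring] at this ⊢
          have h2 := h1.2.2.2.1 (by rw [this]; simp)
          rw [h2.2, ihi (by omega)]
      intro i hi
      rw [show (r + 1) * n + i = r * n + i + n by ring]
      refine ⟨?_, hh i hi, (hsym i hi).1, (hsym i hi).2⟩
      rw [(hrel' i (by omega)).1, hc]
  obtain ⟨q', s, h1, -, -⟩ := (hR (K * n + 0) (hbase K 0 le_rfl (by omega))).2.2.2.2.2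
  have d := hdata K le_rfl 0 (by omega)
  rw [d.1, d.2.1] at h1
  rw [step_eq M _ h1] at hK
  simp at hK

/-- The correct cell at row `r`, column `i`. -/
def trueCell {S : Finset Λ} (k : ℕ → TM0.Cfg Γ Λ) (hk : ∀ r, (k r).q ∈ S) (r i : ℕ) : Cell S Γ :=
  ⟨decide (i = 0), decide (i = r), ⟨(k r).q, hk r⟩, (k r).Tape.nth 0, (k r).Tape.nth i,
    (k r).Tape.nth (-i)⟩

theorem conf_supp (M : TM0.Machine Γ Λ) (S : Finset Λ) (hS : TM0.Supports M (S : Set Λ))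
    (c0 : TM0.Cfg Γ Λ) (h0 : c0.q ∈ S) (r : ℕ) : (conf M c0 r).q ∈ S := by
  induction r with
  | zero => exact h0
  | succ r ih =>
    rw [conf_succ, stepD]
    cases h : TM0.step M (conf M c0 r) with
    | none => exact ih
    | some d => exact TM0.step_supports M hS h ih

theorem complete (M : TM0.Machine Γ Λ) (S : Finset Λ) (c0 : TM0.Cfg Γ Λ)
    (hk : ∀ r, (conf M c0 r).q ∈ S)
    (hH : ∀ r, TM0.step M (conf M c0 r) ≠ none) (n : ℕ) (hn : 0 < n) (t : ℕ) :
    LocRel M S (trueCell (conf M c0) hk (t / n) (t % n))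
      (trueCell (conf M c0) hk ((t + 1) / n) ((t + 1) % n))
      (trueCell (conf M c0) hk ((t + n) / n) ((t + n) % n))
      (trueCell (conf M c0) hk ((t + n + 1) / n) ((t + n + 1) % n)) := by
  obtain ⟨r, i, hi, rfl⟩ : ∃ r i, i < n ∧ t = r * n + i :=
    ⟨t / n, t % n, Nat.mod_lt t hn, (Nat.div_add_mod' t n).symm⟩
  have key : ∀ r i, i < n → (r * n + i) / n = r ∧ (r * n + i) % n = i := by
    intro r i hi
    constructor
    · rw [mul_comm, Nat.mul_add_div hn, Nat.div_eq_of_lt hi, add_zero]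
    · rw [mul_comm, Nat.mul_add_mod, Nat.mod_eq_of_lt hi]
  have e1 : r * n + i + n = (r + 1) * n + i := by ring
  rw [e1, (key r i hi).1, (key r i hi).2, (key (r + 1) i hi).1, (key (r + 1) i hi).2]
  obtain ⟨q', s, hM⟩ : ∃ q' s, M (conf M c0 r).q ((conf M c0 r).Tape.nth 0) = some (q', s) := by
    cases h : M (conf M c0 r).q ((conf M c0 r).Tape.nth 0) with
    | none =>
      exfalso
      apply hH r
      rw [Tape.nth_zero] at h
      have : TM0.step M ⟨(conf M c0 r).q, (conf M c0 r).Tape⟩ = none := by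
        simp only [TM0.step]
        rw [h]; rfl
      exact this
    | some p => exact ⟨p.1, p.2, rfl⟩
  have hst := step_eq M _ hM
  have hc : conf M c0 (r + 1) = ⟨q', act s (conf M c0 r).Tape⟩ := by
    rw [conf_succ, stepD, hst]; exact Option.getD_some
  by_cases h : i + 1 < n
  · have e2 : r * n + i + 1 = r * n + (i + 1) := by ring
    have e3 : (r + 1) * n + i + 1 = (r + 1) * n + (i + 1) := by ring
    rw [e2, e3, (key r _ h).1, (key r _ h).2, (key (r + 1) _ h).1, (key (r + 1) _ h).2]
    refine ⟨rfl, ?_, ?_, ?_, ?_, q', s, hM, ?_, ?_⟩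
    · simp [trueCell]; omega
    · simp [trueCell]
    · simp [trueCell]
    · simp +contextual [trueCell]
    · simp [trueCell, hc]
    · rcases s with d | c
      · rcases d with _ | _ <;> intro _ <;> simp only [trueCell, hc, act, Tape.move_left_nth, Tape.move_right_nth] <;>
          constructor <;> congr 1 <;> push_cast <;> ring
      · simp +contextual [StmtRel, trueCell, hc, act, Tape.write_nth]
        intro _; rfl
  · have hi' : i + 1 = n := by omega
    have e2 : r * n + i + 1 = (r + 1) * n + 0 := by rw [add_assoc, hi']; ring
    have e3 : (r + 1) * n + i + 1 = (r + 2) * n + 0 := by rw [add_assoc, hi']; ring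
    rw [e2, e3, (key _ 0 hn).1, (key _ 0 hn).2, (key (r + 2) 0 hn).1, (key (r + 2) 0 hn).2]
    refine ⟨rfl, ?_, ?_, ?_, ?_, q', s, hM, ?_, ?_⟩
    · simp [trueCell]; omega
    · simp [trueCell]
    · simp [trueCell]
    · simp +contextual [trueCell]
    · simp [trueCell, hc]
    · rcases s with d | c
      · rcases d with _ | _ <;> intro hf <;> simp [trueCell] at hf
      · simp +contextual [StmtRel, trueCell, hc, act, Tape.write_nth]
        intro _; rfl

end PtaUndec
namespace PtaUndec

theorem decode_not (c : ℕ) : decodeMTL (4 * c + 1) = MTL.not (decodeMTL c) := by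
  have h1 : (4 * c + 1) % 4 = 1 := by omega
  have h2 : (4 * c + 1) / 4 = c := by omega
  rw [decodeMTL]
  simp only [h1, h2]

theorem decode_and (a b : ℕ) :
    decodeMTL (4 * Nat.pair a b + 2) = MTL.and (decodeMTL a) (decodeMTL b) := by
  have h1 : (4 * Nat.pair a b + 1 + 1) % 4 = 2 := by omega
  have h2 : (4 * Nat.pair a b + 1 + 1) / 4 = Nat.pair a b := by omega
  rw [show 4 * Nat.pair a b + 2 = (4 * Nat.pair a b + 1) + 1 from rfl, decodeMTL]
  simp only [h1, h2, Nat.unpair_pair]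

theorem decode_untl (a b I : ℕ) :
    decodeMTL (4 * Nat.pair (Nat.pair a b) I + 3) =
      MTL.untl (decodeMTL a) (decodeMTL b) (decodeInterval I) := by
  have h1 : (4 * Nat.pair (Nat.pair a b) I + 2 + 1) % 4 = 3 := by omega
  have h2 : (4 * Nat.pair (Nat.pair a b) I + 2 + 1) / 4 = Nat.pair (Nat.pair a b) I := by omega
  rw [show 4 * Nat.pair (Nat.pair a b) I + 3 = (4 * Nat.pair (Nat.pair a b) I + 2) + 1 from rfl,
    decodeMTL]
  simp only [h1, h2, Nat.unpair_pair]

theorem decode_atom (a : ℕ) : decodeMTL (4 * a) = MTL.atom a := by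
  rcases a with _ | a
  · simp [decodeMTL]
  · have h1 : (4 * a + 3 + 1) % 4 = 0 := by omega
    have h2 : (4 * a + 3 + 1) / 4 = a + 1 := by omega
    rw [show 4 * (a + 1) = (4 * a + 3) + 1 from rfl, decodeMTL]
    simp only [h1, h2]

theorem decodeInterval_surj (I : MTLInterval) : ∃ q, decodeInterval q = I := by
  obtain ⟨lo, hi, ls, hs⟩ := I
  refine ⟨Nat.pair (Nat.pair lo (match hi with | none => 0 | some k => k + 1))
    (Nat.pair ls.toNat hs.toNat), ?_⟩
  rcases hi with _ | k <;> cases ls <;> cases hs <;> simp [decodeInterval]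

theorem decodeMTL_surj (φ : MTL ℕ) : ∃ c, decodeMTL c = φ := by
  induction φ with
  | atom a => exact ⟨_, decode_atom a⟩
  | not φ ih => obtain ⟨c, rfl⟩ := ih; exact ⟨_, decode_not c⟩
  | and φ ψ ih1 ih2 =>
    obtain ⟨a, rfl⟩ := ih1; obtain ⟨b, rfl⟩ := ih2; exact ⟨_, decode_and a b⟩
  | untl φ ψ I ih1 ih2 =>
    obtain ⟨a, rfl⟩ := ih1; obtain ⟨b, rfl⟩ := ih2; obtain ⟨q, rfl⟩ := decodeInterval_surj I
    exact ⟨_, decode_untl a b q⟩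

/-- An operation on formulae that is primitive recursive on codes. -/
def CodedOp (G : MTL ℕ → MTL ℕ) : Prop :=
  ∃ g : ℕ → ℕ, Primrec g ∧ ∀ c, decodeMTL (g c) = G (decodeMTL c)

theorem CodedOp.id : CodedOp (fun φ => φ) := ⟨fun c => c, Primrec.id, fun _ => rfl⟩

theorem CodedOp.const (φ : MTL ℕ) : CodedOp (fun _ => φ) := by
  obtain ⟨c, hc⟩ := decodeMTL_surj φ
  exact ⟨fun _ => c, Primrec.const c, fun _ => hc⟩

theorem CodedOp.not {G : MTL ℕ → MTL ℕ} (h : CodedOp G) : CodedOp (fun φ => MTL.not (G φ)) := by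
  obtain ⟨g, hg, h⟩ := h
  refine ⟨fun c => 4 * g c + 1, ?_, fun c => by rw [decode_not, h]⟩
  exact Primrec.nat_add.comp (Primrec.nat_mul.comp (Primrec.const 4) hg) (Primrec.const 1)

theorem CodedOp.and {G H : MTL ℕ → MTL ℕ} (h : CodedOp G) (h' : CodedOp H) :
    CodedOp (fun φ => MTL.and (G φ) (H φ)) := by
  obtain ⟨g, hg, h⟩ := h
  obtain ⟨g', hg', h'⟩ := h'
  refine ⟨fun c => 4 * Nat.pair (g c) (g' c) + 2, ?_, fun c => by rw [decode_and, h, h']⟩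
  exact Primrec.nat_add.comp (Primrec.nat_mul.comp (Primrec.const 4)
    (Primrec₂.natPair.comp hg hg')) (Primrec.const 2)

theorem CodedOp.untl {G H : MTL ℕ → MTL ℕ} (h : CodedOp G) (h' : CodedOp H) (I : MTLInterval) :
    CodedOp (fun φ => MTL.untl (G φ) (H φ) I) := by
  obtain ⟨g, hg, h⟩ := h
  obtain ⟨g', hg', h'⟩ := h'
  obtain ⟨q, rfl⟩ := decodeInterval_surj I
  refine ⟨fun c => 4 * Nat.pair (Nat.pair (g c) (g' c)) q + 3, ?_,
    fun c => by rw [decode_untl, h, h']⟩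
  exact Primrec.nat_add.comp (Primrec.nat_mul.comp (Primrec.const 4)
    (Primrec₂.natPair.comp (Primrec₂.natPair.comp hg hg') (Primrec.const q))) (Primrec.const 3)

theorem CodedOp.or {G H : MTL ℕ → MTL ℕ} (h : CodedOp G) (h' : CodedOp H) :
    CodedOp (fun φ => MTL.or (G φ) (H φ)) := (h.not.and h'.not).not

theorem CodedOp.iterate {G H : MTL ℕ → MTL ℕ} (hG : CodedOp G) (hH : CodedOp H) (φ : MTL ℕ) :
    ∃ c : ℕ → ℕ, Primrec c ∧ ∀ m, decodeMTL (c m) = H (G^[m] φ) := by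
  obtain ⟨g, hg, h⟩ := hG
  obtain ⟨g', hg', h'⟩ := hH
  obtain ⟨c, rfl⟩ := decodeMTL_surj φ
  refine ⟨fun m => g' (g^[m] c), ?_, fun m => ?_⟩
  · exact hg'.comp (Primrec.nat_iterate Primrec.id (Primrec.const c) (hg.comp Primrec.snd))
  · rw [h']
    congr 1
    induction m with
    | zero => rfl
    | succ m ih => rw [Function.iterate_succ_apply', Function.iterate_succ_apply', h, ih]

end PtaUndec
namespace PtaUndec

/-- The word `w` reads the letters `enc (W i)` at the times `(i + 1) ν`. -/
structure Reg {C : Type} (w : List (ℕ × ℝ)) (ν : ℝ) (enc : C → ℕ) (W : ℕ → C) : Prop where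
  letter : ∀ i < w.length, (w[i]?).map Prod.fst = some (enc (W i))
  time : ∀ i < w.length, tstamp w i = (i + 1) * ν
  nonneg : 0 ≤ ν

theorem sat_not (w : List (ℕ × ℝ)) (φ : MTL ℕ) (i : ℕ) :
    MTL.Sat w (.not φ) i ↔ ¬ MTL.Sat w φ i := Iff.rfl

theorem sat_and (w : List (ℕ × ℝ)) (φ ψ : MTL ℕ) (i : ℕ) :
    MTL.Sat w (.and φ ψ) i ↔ MTL.Sat w φ i ∧ MTL.Sat w ψ i := Iff.rfl

theorem sat_or (w : List (ℕ × ℝ)) (φ ψ : MTL ℕ) (i : ℕ) :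
    MTL.Sat w (.or φ ψ) i ↔ MTL.Sat w φ i ∨ MTL.Sat w ψ i := by
  simp only [MTL.or, sat_not, sat_and]; tauto

theorem sat_tt (w : List (ℕ × ℝ)) (i : ℕ) : MTL.Sat w MTL.tt i := by
  simp only [MTL.tt, sat_or, sat_not]; tauto

theorem sat_ff (w : List (ℕ × ℝ)) (i : ℕ) : ¬ MTL.Sat w MTL.ff i := by
  simp only [MTL.ff, sat_not, not_not]; exact sat_tt w i

theorem sat_bigOr (w : List (ℕ × ℝ)) (l : List (MTL ℕ)) (i : ℕ) :
    MTL.Sat w (MTL.bigOr l) i ↔ ∃ φ ∈ l, MTL.Sat w φ i := by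
  induction l with
  | nil => simp [MTL.bigOr, sat_ff]
  | cons a l ih =>
    have : MTL.bigOr (a :: l) = MTL.or a (MTL.bigOr l) := rfl
    rw [this, sat_or, ih]; simp

/-- Finite disjunction over the elements of a finite type satisfying a predicate. -/
def disj {T : Type} [Fintype T] (p : T → Prop) (φ : T → MTL ℕ) : MTL ℕ :=
  open Classical in MTL.bigOr ((Finset.univ.filter p).toList.map φ)

theorem sat_disj {T : Type} [Fintype T] (p : T → Prop) (φ : T → MTL ℕ) (w : List (ℕ × ℝ)) (i : ℕ) :
    MTL.Sat w (disj p φ) i ↔ ∃ c, p c ∧ MTL.Sat w (φ c) i := by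
  simp [disj, sat_bigOr]

theorem mem_full (t : ℝ) : MTLInterval.full.Mem t ↔ 0 ≤ t := by
  simp [MTLInterval.Mem, MTLInterval.full]

theorem mem_exactly (n : ℕ) (t : ℝ) : (MTLInterval.exactly n).Mem t ↔ t = n := by
  simp only [MTLInterval.Mem, MTLInterval.exactly]
  simp only [Bool.false_eq_true, if_false]
  exact ⟨fun h => le_antisymm h.2 h.1, fun h => ⟨h.ge, h.le⟩⟩

/-- The predicate `p` on letters as a formula. -/
def pr {C : Type} [Fintype C] (enc : C → ℕ) (p : C → Prop) : MTL ℕ := disj p (fun c => .atom (enc c))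

/-- Next. -/
def nx (φ : MTL ℕ) : MTL ℕ := .untl .ff φ .full

/-- After exactly one time unit. -/
def f1 (φ : MTL ℕ) : MTL ℕ := .untl .tt φ (.exactly 1)

/-- Eventually (now or in the future). -/
def ev (φ : MTL ℕ) : MTL ℕ := .or φ (.untl .tt φ .full)

section
variable {C : Type} {w : List (ℕ × ℝ)} {ν : ℝ} {enc : C → ℕ} {W : ℕ → C}

theorem Reg.diff (h : Reg w ν enc W) {i j : ℕ} (hi : i < j) (hj : j < w.length) :
    tstamp w j - tstamp w i = ((j - i : ℕ) : ℝ) * ν := by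
  rw [h.time j hj, h.time i (hi.trans hj), Nat.cast_sub hi.le]; ring

theorem Reg.sat_full (h : Reg w ν enc W) (φ ψ : MTL ℕ) (i : ℕ) :
    MTL.Sat w (.untl φ ψ .full) i ↔ ∃ j, i < j ∧ j < w.length ∧ MTL.Sat w ψ j ∧
      ∀ k, i < k → k < j → MTL.Sat w φ k := by
  constructor
  · rintro ⟨j, h1, h2, h3, _, h4⟩; exact ⟨j, h1, h2, h3, h4⟩
  · rintro ⟨j, h1, h2, h3, h4⟩
    refine ⟨j, h1, h2, h3, ?_, h4⟩
    rw [mem_full, h.diff h1 h2]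
    exact mul_nonneg (Nat.cast_nonneg _) h.nonneg

theorem Reg.sat_one (h : Reg w ν enc W) {n : ℕ} (hn : (n : ℝ) * ν = 1) (φ ψ : MTL ℕ) (i : ℕ) :
    MTL.Sat w (.untl φ ψ (.exactly 1)) i ↔ i + n < w.length ∧ MTL.Sat w ψ (i + n) ∧
      ∀ k, i < k → k < i + n → MTL.Sat w φ k := by
  have n0 : 0 < n := by
    rcases Nat.eq_zero_or_pos n with rfl | h
    · simp at hn
    · exact h
  constructor
  · rintro ⟨j, h1, h2, h3, h5, h4⟩
    rw [mem_exactly, h.diff h1 h2, Nat.cast_one, ← hn] at h5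
    have ν0 : ν ≠ 0 := by rintro rfl; simp at hn
    have := Nat.cast_injective (mul_right_cancel₀ ν0 h5)
    obtain rfl : j = i + n := by omega
    exact ⟨h2, h3, h4⟩
  · rintro ⟨h2, h3, h4⟩
    refine ⟨i + n, by omega, h2, h3, ?_, h4⟩
    rw [mem_exactly, h.diff (by omega) h2]
    simpa using hn

theorem Reg.sat_nx (h : Reg w ν enc W) (φ : MTL ℕ) (i : ℕ) :
    MTL.Sat w (nx φ) i ↔ i + 1 < w.length ∧ MTL.Sat w φ (i + 1) := by
  rw [nx, h.sat_full]
  constructor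
  · rintro ⟨j, h1, h2, h3, h4⟩
    obtain rfl : j = i + 1 := by
      by_contra hne
      exact sat_ff w _ (h4 (i + 1) (by omega) (by omega))
    exact ⟨h2, h3⟩
  · rintro ⟨h1, h2⟩
    exact ⟨i + 1, by omega, h1, h2, by omega⟩

theorem Reg.sat_f1 (h : Reg w ν enc W) {n : ℕ} (hn : (n : ℝ) * ν = 1) (φ : MTL ℕ) (i : ℕ) :
    MTL.Sat w (f1 φ) i ↔ i + n < w.length ∧ MTL.Sat w φ (i + n) := by
  rw [f1, h.sat_one hn]
  simp [sat_tt]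

theorem Reg.sat_ev (h : Reg w ν enc W) (φ : MTL ℕ) (h0 : 0 < w.length) :
    MTL.Sat w (ev φ) 0 ↔ ∃ t < w.length, MTL.Sat w φ t := by
  rw [ev, sat_or, h.sat_full]
  constructor
  · rintro (h | ⟨j, _, h1, h2, _⟩)
    · exact ⟨0, h0, h⟩
    · exact ⟨j, h1, h2⟩
  · rintro ⟨t, h1, h2⟩
    rcases Nat.eq_zero_or_pos t with rfl | ht
    · exact Or.inl h2
    · exact Or.inr ⟨t, ht, h1, h2, fun _ _ _ => sat_tt w _⟩

theorem Reg.sat_atom (h : Reg w ν enc W) (he : Function.Injective enc) (c : C) {i : ℕ}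
    (hi : i < w.length) : MTL.Sat w (.atom (enc c)) i ↔ W i = c := by
  simp only [MTL.Sat, h.letter i hi, Option.some.injEq]
  exact he.eq_iff

variable [Fintype C]

theorem Reg.sat_pr (h : Reg w ν enc W) (he : Function.Injective enc) (p : C → Prop) {i : ℕ}
    (hi : i < w.length) : MTL.Sat w (pr enc p) i ↔ p (W i) := by
  rw [pr, sat_disj]
  constructor
  · rintro ⟨c, hc, h1⟩; rw [h.sat_atom he c hi] at h1; rwa [h1]
  · intro hp; exact ⟨W i, hp, (h.sat_atom he _ hi).2 rfl⟩

/-- Step formula for the initial row. -/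
def Zop (enc : C → ℕ) (fst pC : C → Prop) (φ : MTL ℕ) : MTL ℕ :=
  nx (.or (pr enc fst) (.and (pr enc pC) φ))

def Z0 (enc : C → ℕ) (fst pD : C → Prop) : MTL ℕ := .untl (pr enc pD) (pr enc fst) .full

theorem Reg.sat_Z (h : Reg w ν enc W) (he : Function.Injective enc) (fst pC pD : C → Prop) {n : ℕ}
    (hn : n < w.length) (hfn : fst (W n)) (hf : ∀ k, 0 < k → k < n → ¬ fst (W k)) (m : ℕ) :
    ∀ p, p < n → (MTL.Sat w ((Zop enc fst pC)^[m] (Z0 enc fst pD)) p ↔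
      ∀ i, p < i → i < n → if i ≤ p + m then pC (W i) else pD (W i)) := by
  induction m with
  | zero =>
    intro p hp
    simp only [Function.iterate_zero, id]
    rw [Z0, h.sat_full]
    constructor
    · rintro ⟨j, h1, h2, h3, h4⟩ i hi1 hi2
      rw [if_neg (by omega)]
      rw [h.sat_pr he _ h2] at h3
      have hj : n ≤ j := by
        by_contra hc
        exact hf j (by omega) (by omega) h3
      have := h4 i hi1 (by omega)
      rwa [h.sat_pr he _ (by omega)] at this
    · intro hh
      refine ⟨n, hp, hn, (h.sat_pr he _ hn).2 hfn, fun k hk1 hk2 => ?_⟩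
      rw [h.sat_pr he _ (by omega)]
      have := hh k hk1 hk2
      rwa [if_neg (by omega)] at this
  | succ m ih =>
    intro p hp
    rw [Function.iterate_succ_apply', Zop, h.sat_nx, sat_or, sat_and, h.sat_pr he _ (by omega),
      h.sat_pr he _ (by omega)]
    by_cases hpn : p + 1 = n
    · rw [hpn]
      exact ⟨fun _ i h1 h2 => by omega, fun _ => ⟨hn, Or.inl hfn⟩⟩
    · have := ih (p + 1) (by omega)
      rw [this]
      constructor
      · rintro ⟨_, h1 | ⟨h1, h2⟩⟩ i hi1 hi2
        · exact absurd h1 (hf _ (by omega) (by omega))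
        · by_cases hi : i = p + 1
          · subst hi; rw [if_pos (by omega)]; exact h1
          · have := h2 i (by omega) hi2
            rwa [show p + 1 + m = p + (m + 1) by ring] at this
      · intro hh
        refine ⟨by omega, Or.inr ⟨?_, fun i h1 h2 => ?_⟩⟩
        · have := hh (p + 1) (by omega) (by omega)
          rwa [if_pos (by omega)] at this
        · have := hh i (by omega) h2
          rwa [show p + 1 + m = p + (m + 1) by ring]

/-- Initial row formula. -/
def initOp (enc : C → ℕ) (fst p0 pB : C → Prop) (φ : MTL ℕ) : MTL ℕ :=
  .and (pr enc p0) (nx (.or (pr enc fst) (.and (pr enc pB) φ)))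

def badF (enc : C → ℕ) (R : C → C → C → C → Prop) : MTL ℕ :=
  disj (fun x : C × C × C × C => ¬ R x.1 x.2.1 x.2.2.1 x.2.2.2)
    (fun x => .and (.atom (enc x.1)) (.and (nx (.atom (enc x.2.1)))
      (f1 (.and (.atom (enc x.2.2.1)) (nx (.atom (enc x.2.2.2)))))))

def rowF (enc : C → ℕ) (fst : C → Prop) : MTL ℕ :=
  .untl (.not (pr enc fst)) (pr enc fst) (.exactly 1)

def finF (enc : C → ℕ) (fst g : C → Prop) : MTL ℕ :=
  ev (.and (pr enc g) (nx (.and (pr enc fst) (nx .tt))))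

def goodOp (enc : C → ℕ) (R : C → C → C → C → Prop) (fst g p0 pB : C → Prop) (φ : MTL ℕ) : MTL ℕ :=
  .and (.and (.not (ev (badF enc R))) (rowF enc fst)) (.and (initOp enc fst p0 pB φ) (finF enc fst g))

theorem Reg.sat_good (h : Reg w ν enc W) (he : Function.Injective enc)
    (R : C → C → C → C → Prop) (fst g p0 pB pC pD : C → Prop) {n : ℕ} (hn : (n : ℝ) * ν = 1)
    (m : ℕ) (hlen : 0 < w.length) :
    MTL.Sat w (goodOp enc R fst g p0 pB ((Zop enc fst pC)^[m] (Z0 enc fst pD))) 0 ↔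
      (∀ t, t + n + 1 < w.length → R (W t) (W (t + 1)) (W (t + n)) (W (t + n + 1))) ∧
      (n < w.length ∧ fst (W n) ∧ ∀ k, 0 < k → k < n → ¬ fst (W k)) ∧
      (∀ i < n, if i = 0 then p0 (W i) else if i = 1 then pB (W i) else
        if i ≤ m + 1 then pC (W i) else pD (W i)) ∧
      ∃ t, t + 2 < w.length ∧ g (W t) ∧ fst (W (t + 1)) := by
  have n0 : 0 < n := by
    rcases Nat.eq_zero_or_pos n with rfl | h
    · simp at hn
    · exact h
  have hbad : MTL.Sat w (.not (ev (badF enc R))) 0 ↔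
      (∀ t, t + n + 1 < w.length → R (W t) (W (t + 1)) (W (t + n)) (W (t + n + 1))) := by
    rw [sat_not, h.sat_ev _ hlen]
    constructor
    · intro hh t ht
      by_contra hR
      refine hh ⟨t, by omega, ?_⟩
      rw [badF, sat_disj]
      refine ⟨(W t, W (t + 1), W (t + n), W (t + n + 1)), hR, ?_⟩
      rw [sat_and, sat_and, h.sat_nx, h.sat_f1 hn, sat_and, h.sat_nx, h.sat_atom he _ (by omega),
        h.sat_atom he _ (by omega), h.sat_atom he _ (by omega), h.sat_atom he _ (by omega)]
      exact ⟨rfl, ⟨by omega, rfl⟩, by omega, rfl, by omega, rfl⟩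
    · rintro hh ⟨t, ht, hs⟩
      rw [badF, sat_disj] at hs
      obtain ⟨⟨x, y, z, u⟩, hR, hs⟩ := hs
      rw [sat_and, sat_and, h.sat_nx, h.sat_f1 hn, sat_and, h.sat_nx] at hs
      obtain ⟨h1, ⟨l2, h2⟩, l3, h3, l4, h4⟩ := hs
      rw [h.sat_atom he _ (by omega)] at h1 h2 h3 h4
      apply hR
      dsimp only at h1 h2 h3 h4 ⊢
      rw [← h1, ← h2, ← h3, ← h4]
      exact hh t l4
  have hrow : MTL.Sat w (rowF enc fst) 0 ↔
      (n < w.length ∧ fst (W n) ∧ ∀ k, 0 < k → k < n → ¬ fst (W k)) := by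
    rw [rowF, h.sat_one hn, zero_add]
    refine and_congr_right fun l => ?_
    rw [h.sat_pr he _ l]
    refine and_congr_right fun _ => ?_
    refine forall_congr' fun k => forall_congr' fun _ => forall_congr' fun hk => ?_
    rw [sat_not, h.sat_pr he _ (by omega)]
  have hfin : MTL.Sat w (finF enc fst g) 0 ↔ ∃ t, t + 2 < w.length ∧ g (W t) ∧ fst (W (t + 1)) := by
    rw [finF, h.sat_ev _ hlen]
    constructor
    · rintro ⟨t, l1, hs⟩
      rw [sat_and, h.sat_nx, sat_and, h.sat_nx] at hs
      obtain ⟨h1, l2, h2, l3, _⟩ := hs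
      rw [h.sat_pr he _ (by omega)] at h1 h2
      exact ⟨t, l3, h1, h2⟩
    · rintro ⟨t, l, h1, h2⟩
      refine ⟨t, by omega, ?_⟩
      rw [sat_and, h.sat_nx, sat_and, h.sat_nx, h.sat_pr he _ (by omega), h.sat_pr he _ (by omega)]
      exact ⟨h1, by omega, h2, l, sat_tt _ _⟩
  rw [goodOp, sat_and, sat_and, sat_and, hbad, hrow, hfin, and_assoc]
  refine and_congr_right fun _ => and_congr_right fun ⟨l, hfn, hf⟩ => and_congr_left fun _ => ?_
  rw [initOp, sat_and, h.sat_nx, sat_or, sat_and, h.sat_pr he _ hlen]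
  rw [h.sat_pr he _ (by omega), h.sat_pr he _ (by omega), zero_add]
  by_cases h1 : n = 1
  · subst h1
    constructor
    · rintro ⟨h2, _⟩ i hi
      obtain rfl : i = 0 := by omega
      rw [if_pos rfl]; exact h2
    · intro hh
      have := hh 0 (by omega)
      rw [if_pos rfl] at this
      exact ⟨this, l, Or.inl hfn⟩
  · have hz := h.sat_Z he fst pC pD l hfn hf m 1 (by omega)
    rw [hz]
    have hf1 : ¬ fst (W 1) := hf 1 (by omega) (by omega)
    constructor
    · rintro ⟨h2, _, h3 | ⟨h3, h4⟩⟩ i hi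
      · exact absurd h3 hf1
      · rcases i with _ | _ | i
        · simpa using h2
        · simpa using h3
        · have := h4 (i + 2) (by omega) hi
          rw [if_neg (by omega), if_neg (by omega)]
          rwa [add_comm 1 m] at this
    · intro hh
      refine ⟨?_, by omega, Or.inr ⟨?_, fun i hi1 hi2 => ?_⟩⟩
      · simpa using hh 0 (by omega)
      · simpa using hh 1 (by omega)
      · have := hh i hi2
        rw [if_neg (by omega), if_neg (by omega)] at this
        rwa [add_comm 1 m]

end

end PtaUndec
namespace PtaUndec

def escF : MTL ℕ :=
  .or (.untl .tt .tt (.exactly 0)) (.and (.untl .tt .tt ⟨1, none, true, false⟩) (.not (f1 .tt)))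

theorem mem_gt (t : ℝ) : (MTLInterval.mk 1 none true false).Mem t ↔ 1 < t := by
  simp [MTLInterval.Mem]

theorem Reg.esc_false {C : Type} {w : List (ℕ × ℝ)} {ν : ℝ} {enc : C → ℕ} {W : ℕ → C}
    (h : Reg w ν enc W) {n : ℕ} (hn : (n : ℝ) * ν = 1) : ¬ MTL.Sat w escF 0 := by
  have ν0 : ν ≠ 0 := by rintro rfl; simp at hn
  have νp : 0 < ν := lt_of_le_of_ne h.nonneg (Ne.symm ν0)
  rw [escF, sat_or, sat_and, sat_not, h.sat_f1 hn]
  rintro (⟨j, h1, h2, _, h3, _⟩ | ⟨⟨j, h1, h2, _, h3, _⟩, h4⟩)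
  · rw [mem_exactly, h.diff h1 h2] at h3
    have : (0 : ℝ) < ((j - 0 : ℕ) : ℝ) := by exact_mod_cast h1
    have := mul_pos this νp
    simp at h3
    rcases h3 with h3 | h3
    · omega
    · exact ν0 h3
  · rw [mem_gt, h.diff h1 h2, ← hn] at h3
    have := lt_of_mul_lt_mul_right h3 h.nonneg
    have : n < j := by simpa using this
    exact h4 ⟨by omega, sat_tt _ _⟩

theorem Reg.esc_true {C : Type} {w : List (ℕ × ℝ)} {ν : ℝ} {enc : C → ℕ} {W : ℕ → C}
    (h : Reg w ν enc W) (hn : ∀ n : ℕ, (n : ℝ) * ν ≠ 1) (hl : 1 < w.length)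
    (hl' : ν ≠ 0 → 1 < ((w.length - 1 : ℕ) : ℝ) * ν) : MTL.Sat w escF 0 := by
  rw [escF, sat_or, sat_and, sat_not]
  by_cases ν0 : ν = 0
  · left
    refine ⟨1, by omega, hl, sat_tt _ _, ?_, fun _ _ _ => sat_tt _ _⟩
    rw [mem_exactly, h.diff (by omega) hl, ν0]; simp
  · right
    refine ⟨⟨w.length - 1, by omega, by omega, sat_tt _ _, ?_, fun _ _ _ => sat_tt _ _⟩, ?_⟩
    · rw [mem_gt, h.diff (by omega) (by omega)]
      exact hl' ν0
    · rintro ⟨j, h1, h2, _, h3, _⟩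
      rw [mem_exactly, h.diff h1 h2] at h3
      exact hn _ (by simpa using h3)

/-- The fixed automaton: one location, reading any letter below `N` every `p` time units. -/
def autoCode (N : ℕ) : PTACode :=
  (0, (List.range N).map (fun a => (0, a, [((2 : Fin 5), (none : Option ℕ))], true, 0)), [0])

theorem mem_edges (N : ℕ) (e) : e ∈ (toPTA (autoCode N)).edges ↔
    ∃ a < N, e = (0, a, interpGuard [((2 : Fin 5), (none : Option ℕ))], Set.univ, 0) := by
  simp only [toPTA, autoCode, Set.mem_ofPred_eq, List.mem_map, List.mem_range]
  constructor
  · rintro ⟨_, ⟨a, ha, rfl⟩, rfl⟩; exact ⟨a, ha, by simp [interpEdge]⟩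
  · rintro ⟨a, ha, rfl⟩; exact ⟨_, ⟨a, ha, rfl⟩, by simp [interpEdge]⟩

theorem auto_det (N : ℕ) : (toPTA (autoCode N)).Deterministic := by
  refine ⟨⟨0, rfl⟩, ?_⟩
  intro e₁ h1 e₂ h2 hne _ hl
  rw [mem_edges] at h1 h2
  obtain ⟨a, _, rfl⟩ := h1
  obtain ⟨b, _, rfl⟩ := h2
  exact absurd (by simp at hl; rw [hl]) hne

theorem guard_sat (c : Unit → ℝ) (π : Unit → ℚ≥0) :
    ClockConstraint.Sat c π (interpGuard [((2 : Fin 5), (none : Option ℕ))]) ↔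
      c () = ((π () : ℚ≥0) : ℝ) := by
  simp [ClockConstraint.Sat, interpGuard, ClockAtom.Sat, cmpOfFin, Cmp.holds]

theorem run_iff (N : ℕ) (π : Unit → ℚ≥0) (w : List (ℕ × ℝ)) : ∀ (t : ℝ) (c : Unit → ℝ), c () = 0 →
    ((toPTA (autoCode N)).Run π 0 c t w ↔
      ∀ i (h : i < w.length), (w[i]).1 < N ∧ (w[i]).2 = t + (i + 1) * ((π () : ℚ≥0) : ℝ)) := by
  induction w with
  | nil =>
    intro t c _
    simp only [List.length_nil, Nat.not_lt_zero, IsEmpty.forall_iff, implies_true, iff_true]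
    exact PTA.Run.nil _ _ _ (by simp [toPTA, autoCode])
  | cons e w ih =>
    intro t c hc
    obtain ⟨a, t'⟩ := e
    constructor
    · intro hr
      cases hr with
      | cons φ lam hle he hg hres hrun =>
        rw [mem_edges] at he
        obtain ⟨a', ha, heq⟩ := he
        simp only [Prod.mk.injEq, true_and] at heq
        obtain ⟨rfl, rfl, rfl, rfl⟩ := heq
        rw [guard_sat, hc] at hg
        have h0 := ((hres ()).1 trivial)
        rw [ih _ _ h0] at hrun
        rintro (_ | i) hi
        · refine ⟨ha, ?_⟩
          simp only [List.getElem_cons_zero]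
          push_cast; linarith
        · have := hrun i (by simpa using hi)
          refine ⟨this.1, ?_⟩
          simp only [List.getElem_cons_succ]
          rw [this.2]
          push_cast; linarith
    · intro hh
      have h0 := hh 0 (by simp)
      simp only [List.getElem_cons_zero] at h0
      have hp : (0 : ℝ) ≤ ((π () : ℚ≥0) : ℝ) := by positivity
      refine PTA.Run.cons (ν' := fun _ => 0) (l' := 0)
        (interpGuard [((2 : Fin 5), (none : Option ℕ))]) Set.univ ?_ ?_ ?_ ?_ ?_
      · rw [h0.2]; push_cast; linarith
      · rw [mem_edges]; exact ⟨a, h0.1, rfl⟩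
      · rw [guard_sat, hc, h0.2]; push_cast; ring
      · intro x; simp
      · rw [ih _ _ rfl]
        intro i hi
        have := hh (i + 1) (by simpa using hi)
        simp only [List.getElem_cons_succ] at this
        refine ⟨this.1, ?_⟩
        rw [this.2, h0.2]; push_cast; ring

theorem lang_iff (N : ℕ) (π : Unit → ℚ≥0) (w : List (ℕ × ℝ)) :
    w ∈ (toPTA (autoCode N)).Lang π ↔ w ≠ [] ∧
      ∀ i (h : i < w.length), (w[i]).1 < N ∧ (w[i]).2 = (i + 1) * ((π () : ℚ≥0) : ℝ) := by
  have hi : (toPTA (autoCode N)).init = {0} := rfl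
  simp only [PTA.Lang, Set.mem_ofPred_eq, hi, Set.mem_singleton_iff, exists_eq_left]
  rw [run_iff N π w 0 _ rfl]
  simp

theorem lang_reg {C : Type} [Fintype C] [Inhabited C] (e : C ≃ Fin (Fintype.card C))
    (π : Unit → ℚ≥0) (w : List (ℕ × ℝ)) (hw : w ∈ (toPTA (autoCode (Fintype.card C))).Lang π) :
    ∃ W : ℕ → C, Reg w ((π () : ℚ≥0) : ℝ) (fun c => (e c : ℕ)) W := by
  rw [lang_iff] at hw
  refine ⟨fun i => if h : i < w.length then e.symm ⟨(w[i]).1, (hw.2 i h).1⟩ else default, ?_, ?_, ?_⟩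
  · intro i hi; simp [hi]
  · intro i hi; simp [tstamp, hi, (hw.2 i hi).2]
  · positivity

/-- The word with letters `enc (W i)`. -/
def mkWord {C : Type} (enc : C → ℕ) (W : ℕ → C) (ν : ℝ) (len : ℕ) : List (ℕ × ℝ) :=
  (List.range len).map fun i => (enc (W i), ((i : ℝ) + 1) * ν)

theorem mkWord_length {C : Type} (enc : C → ℕ) (W : ℕ → C) (ν : ℝ) (len : ℕ) :
    (mkWord enc W ν len).length = len := by simp [mkWord]

theorem mkWord_reg {C : Type} (enc : C → ℕ) (W : ℕ → C) (ν : ℝ) (hν : 0 ≤ ν) (len : ℕ) :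
    Reg (mkWord enc W ν len) ν enc W := by
  refine ⟨?_, ?_, hν⟩
  · intro i hi
    rw [mkWord_length] at hi
    simp [mkWord, hi]
  · intro i hi
    rw [mkWord_length] at hi
    simp [mkWord, hi, tstamp]

theorem mkWord_mem {C : Type} [Fintype C] (e : C ≃ Fin (Fintype.card C)) (W : ℕ → C)
    (π : Unit → ℚ≥0) {len : ℕ} (hl : 0 < len) :
    mkWord (fun c => (e c : ℕ)) W ((π () : ℚ≥0) : ℝ) len ∈
      (toPTA (autoCode (Fintype.card C))).Lang π := by
  rw [lang_iff]
  constructor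
  · intro h
    have := congrArg List.length h
    rw [mkWord_length] at this
    simp at this; omega
  · intro i hi
    simp [mkWord]

end PtaUndec
namespace PtaUndec

open Turing

variable {Γ Λ : Type} [Inhabited Γ] [Inhabited Λ]

def cellP0 {S : Finset Λ} (A : Γ) (c : Cell S Γ) : Prop :=
  c.f = true ∧ c.g = true ∧ c.q.1 = default ∧ c.h = A ∧ c.a = A ∧ c.b = A

def cellP {S : Finset Λ} (A s : Γ) (c : Cell S Γ) : Prop :=
  c.f = false ∧ c.g = false ∧ c.q.1 = default ∧ c.h = A ∧ c.a = s ∧ c.b = default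

theorem nth_nat (l : List Γ) (i : ℕ) : (Tape.mk₁ l).nth (i : ℤ) = l.getI i := by
  rw [Tape.mk₁, Tape.mk₂, Tape.mk'_nth_nat]
  simp

theorem nth_neg (l : List Γ) (i : ℕ) : (Tape.mk₁ l).nth (-((i + 1 : ℕ) : ℤ)) = default := by
  have : (-((i + 1 : ℕ) : ℤ)) = Int.negSucc i := rfl
  rw [this]
  simp [Tape.mk₁, Tape.mk₂, Tape.mk', Tape.nth]

theorem init_cell {S : Finset Λ} (A B C : Γ) (m i : ℕ) (c : Cell S Γ) :
    (if i = 0 then cellP0 A c else if i = 1 then cellP A B c else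
        if i ≤ m + 1 then cellP A C c else cellP A default c) ↔
      DataOk (TM0.init (A :: B :: List.replicate m C)) i c ∧ c.f = decide (i = 0) ∧
        c.g = decide (i = 0) := by
  have h0 : (Tape.mk₁ (A :: B :: List.replicate m C)).nth 0 = A := by
    have := nth_nat (A :: B :: List.replicate m C) 0
    simpa using this
  rcases i with _ | i
  · simp [DataOk, TM0.init, h0, cellP0]
    tauto
  · simp only [DataOk, TM0.init, h0, nth_nat, nth_neg, cellP]
    rcases i with _ | i
    · simp; tauto
    · by_cases hi : i < m
      · have : (A :: B :: List.replicate m C).getI (i + 1 + 1) = C := by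
          rw [List.getI_cons_succ, List.getI_cons_succ, List.getI_eq_getElem _ (by simpa using hi)]
          simp
        rw [this]
        simp [show i + 1 + 1 ≤ m + 1 by omega]; tauto
      · have : (A :: B :: List.replicate m C).getI (i + 1 + 1) = default := by
          rw [List.getI_cons_succ, List.getI_cons_succ, List.getI_eq_default _ (by simpa using hi)]
        rw [this]
        simp [show ¬ i + 1 + 1 ≤ m + 1 by omega]; tauto

/-- The full formula, as a function of the initial-row formula. -/
def fullOp [Fintype Γ] (M : TM0.Machine Γ Λ) (S : Finset Λ) (enc : Cell S Γ → ℕ) (A B : Γ)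
    (φ : MTL ℕ) : MTL ℕ :=
  .not (.or escF (goodOp enc (LocRel M S) (fun c => c.f = true) (fun c => c.g = true)
    (cellP0 A) (cellP A B) φ))

theorem fullOp_coded [Fintype Γ] (M : TM0.Machine Γ Λ) (S : Finset Λ) (enc : Cell S Γ → ℕ)
    (A B C : Γ) : ∃ c : ℕ → ℕ, Primrec c ∧ ∀ m, decodeMTL (c m) =
      fullOp M S enc A B ((Zop enc (fun c => c.f = true) (cellP A C))^[m]
        (Z0 enc (fun c => c.f = true) (cellP A default))) := by
  apply CodedOp.iterate
  · exact CodedOp.untl (CodedOp.const _) ((CodedOp.const _).or ((CodedOp.const _).and CodedOp.id)) _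
  · refine ((CodedOp.const _).or ((CodedOp.const _).and (CodedOp.and ?_ (CodedOp.const _)))).not
    refine (CodedOp.const _).and ?_
    exact CodedOp.untl (CodedOp.const _) ((CodedOp.const _).or ((CodedOp.const _).and CodedOp.id)) _

theorem reduction [Fintype Γ] (M : TM0.Machine Γ Λ) (S : Finset Λ)
    (hS : TM0.Supports M (S : Set Λ)) (e : Cell S Γ ≃ Fin (Fintype.card (Cell S Γ)))
    (A B C : Γ) (m : ℕ) :
    (StateTransition.eval (TM0.step M) (TM0.init (A :: B :: List.replicate m C))).Dom ↔
      ∃ ν : Unit → ℚ≥0, ∀ w ∈ (toPTA (autoCode (Fintype.card (Cell S Γ)))).Lang ν,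
        MTL.Sat w (fullOp M S (fun c => (e c : ℕ)) A B
          ((Zop (fun c => (e c : ℕ)) (fun c => c.f = true) (cellP A C))^[m]
        (Z0 (fun c => (e c : ℕ)) (fun c => c.f = true) (cellP A default)))) 0 := by
  have he : Function.Injective (fun c => (e c : ℕ)) := Fin.val_injective.comp e.injective
  haveI : Inhabited (Cell S Γ) := ⟨⟨false, false, ⟨default, hS.1⟩, default, default, default⟩⟩
  rw [dom_iff]
  constructor
  · rintro ⟨K, hK⟩
    refine ⟨fun _ => 1 / ((K + 2 : ℕ) : ℚ≥0), fun w hw => ?_⟩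
    obtain ⟨W, hW⟩ := lang_reg e _ w hw
    have hn : ((K + 2 : ℕ) : ℝ) * (((1 / ((K + 2 : ℕ) : ℚ≥0) : ℚ≥0)) : ℝ) = 1 := by
      push_cast
      field_simp
    have hlen : 0 < w.length := List.length_pos_iff.2 hw.1
    rw [fullOp, sat_not, sat_or, hW.sat_good he _ _ _ _ _ _ _ hn m hlen]
    rintro (h | ⟨h1, h2, h3, h4⟩)
    · exact hW.esc_false hn h
    · exact sound M S _ W (K + 2) K w.length le_rfl hK h1
        (fun i hi => (init_cell A B C m i (W i)).1 (h3 i hi)) h4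
  · rintro ⟨ν, hν⟩
    by_contra hH
    push Not at hH
    have hν0 : (0 : ℝ) ≤ ((ν () : ℚ≥0) : ℝ) := by positivity
    by_cases hn : ∃ n : ℕ, (n : ℝ) * ((ν () : ℚ≥0) : ℝ) = 1
    · obtain ⟨n, hn⟩ := hn
      have n0 : 0 < n := by
        rcases Nat.eq_zero_or_pos n with rfl | h
        · simp at hn
        · exact h
      have hk := conf_supp M S hS (TM0.init (A :: B :: List.replicate m C)) hS.1
      set W : ℕ → Cell S Γ := fun t => trueCell (conf M _) hk (t / n) (t % n) with hWdef
      have hmem := hν _ (mkWord_mem e W ν (len := n * n + 2) (by omega))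
      have hreg := mkWord_reg (fun c => (e c : ℕ)) W _ hν0 (n * n + 2)
      have hl := mkWord_length (fun c => (e c : ℕ)) W ((ν () : ℚ≥0) : ℝ) (n * n + 2)
      rw [fullOp, sat_not, sat_or, hreg.sat_good he _ _ _ _ _ _ _ hn m (by omega), hl] at hmem
      have nn : n ≤ n * n := Nat.le_mul_self n
      refine hmem (Or.inr ⟨?_, ⟨by omega, ?_, ?_⟩, ?_, ?_⟩)
      · intro t _
        exact complete M S _ hk hH n n0 t
      · simp [hWdef, trueCell]
      · intro k hk1 hk2
        simp only [hWdef, trueCell, Nat.mod_eq_of_lt hk2]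
        simp; omega
      · intro i hi
        rw [init_cell]
        simp only [hWdef, Nat.mod_eq_of_lt hi, Nat.div_eq_of_lt hi]
        exact ⟨⟨rfl, rfl, rfl, rfl⟩, rfl, rfl⟩
      · refine ⟨n * n - 1, by omega, ?_, ?_⟩
        · have e1 : n * n - 1 = n * (n - 1) + (n - 1) := by
            obtain ⟨k, rfl⟩ : ∃ k, n = k + 1 := ⟨n - 1, by omega⟩
            simp only [Nat.add_sub_cancel]
            have : (k + 1) * (k + 1) = (k + 1) * k + k + 1 := by ring
            omega
          have e2 : (n * n - 1) / n = n - 1 := by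
            rw [e1, Nat.mul_add_div n0, Nat.div_eq_of_lt (by omega), add_zero]
          have e3 : (n * n - 1) % n = n - 1 := by
            rw [e1, Nat.mul_add_mod, Nat.mod_eq_of_lt (by omega)]
          simp [hWdef, trueCell, e2, e3]
        · have : n * n - 1 + 1 = n * n := by omega
          simp [hWdef, trueCell, this]
    · push Not at hn
      obtain ⟨J, hJ⟩ : ∃ J : ℕ, ((ν () : ℚ≥0) : ℝ) ≠ 0 → 1 < (J : ℝ) * ((ν () : ℚ≥0) : ℝ) := by
        by_cases h0 : ((ν () : ℚ≥0) : ℝ) = 0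
        · exact ⟨0, fun h => absurd h0 h⟩
        · have hp : 0 < ((ν () : ℚ≥0) : ℝ) := lt_of_le_of_ne hν0 (Ne.symm h0)
          obtain ⟨J, hJ⟩ := exists_nat_gt (1 / ((ν () : ℚ≥0) : ℝ))
          exact ⟨J, fun _ => by rwa [div_lt_iff₀ hp] at hJ⟩
      set W : ℕ → Cell S Γ := fun _ => default
      have hmem := hν _ (mkWord_mem e W ν (len := J + 2) (by omega))
      have hreg := mkWord_reg (fun c => (e c : ℕ)) W _ hν0 (J + 2)
      have hl := mkWord_length (fun c => (e c : ℕ)) W ((ν () : ℚ≥0) : ℝ) (J + 2)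
      rw [fullOp, sat_not, sat_or] at hmem
      refine hmem (Or.inl (hreg.esc_true hn (by omega) fun h => ?_))
      rw [hl]
      refine (hJ h).trans_le ?_
      gcongr
      omega

end PtaUndec

/-- The MTL-model checking problem for parametric timed automata — given a
parametric timed automaton `A` and an MTL formula `φ`, decide whether there exists a
parameter valuation `ν` such that every timed word in `L_ν(A)` satisfies `φ` — is
undecidable, even when restricted to inputs where `A` is deterministic and uses only one
clock and one parameter: no computable function decides it on such inputs. -/
theorem mtl_model_checking_pta_undecidable :
    ¬ ∃ f : PTACode × ℕ → Bool, Computable f ∧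
      ∀ (A : PTACode) (c : ℕ), (toPTA A).Deterministic →
        (f (A, c) = true ↔
          ∃ ν : Unit → ℚ≥0, ∀ w ∈ (toPTA A).Lang ν, MTL.Sat w (decodeMTL c) 0) := by
  rintro ⟨f, hf, hdec⟩
  obtain ⟨Γ, Λ, _, _, _, M, S, A, B, C, hS, hund⟩ := PtaUndec.exists_machine
  apply hund
  let e := Fintype.equivFin (PtaUndec.Cell S Γ)
  obtain ⟨c, hc, hcm⟩ := PtaUndec.fullOp_coded M S (fun c => (e c : ℕ)) A B C
  rw [ComputablePred.computable_iff]
  refine ⟨fun m => f (PtaUndec.autoCode (Fintype.card (PtaUndec.Cell S Γ)), c m),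
    hf.comp ((Computable.const _).pair hc.to_comp), ?_⟩
  funext m
  rw [PtaUndec.reduction M S hS e A B C m]
  apply propext
  have := hdec (PtaUndec.autoCode (Fintype.card (PtaUndec.Cell S Γ))) (c m) (PtaUndec.auto_det _)
  rw [hcm] at this
  exact this.symm
end
end

section
/- Let n ∈ ℕ and let w ∈ L(C,n), written in its canonical block form with blocks w_i containing n_i symbols of M ∪ {#} at fractional offsets 0 < δ^i_1 < … < δ^i_{n_i} < 1 within the i-th block, for i = 1,…,N. Then for every i ∈ {1,…,N−1} there exists a strictly increasing function f_i : {1,…,n_i} → {1,…,n_{i+1}} such that δ^i_j = δ^{i+1}_{f_i(j)} for every j ∈ {1,…,n_i}. -/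
open scoped NNRat

noncomputable section

/-! ### Channel machines -/

/-- Labels of a channel machine: `m!` (send), `m?` (receive), or `ε`. -/
inductive CMLabel (M : Type) : Type
  | send : M → CMLabel M
  | recv : M → CMLabel M
  | eps : CMLabel M
  deriving DecidableEq

/-- A channel machine `C = (S, s_I, M, Δ)`: finite-state automaton acting on an
unbounded fifo channel. -/
structure ChannelMachine (S M : Type) where
  init : S
  trans : Finset (S × CMLabel M × S)

/-- The error-free transition relation `→` on configurations `(s, x)`. -/
inductive CMStep {S M : Type} (C : ChannelMachine S M) :
    S × List M → CMLabel M → S × List M → Prop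
  | send {s s' : S} {x : List M} {m : M} :
      (s, CMLabel.send m, s') ∈ C.trans →
      CMStep C (s, x) (CMLabel.send m) (s', x ++ [m])
  | recv {s s' : S} {x : List M} {m : M} :
      (s, CMLabel.recv m, s') ∈ C.trans →
      CMStep C (s, m :: x) (CMLabel.recv m) (s', x)
  | eps {s s' : S} :
      (s, CMLabel.eps, s') ∈ C.trans →
      CMStep C (s, []) CMLabel.eps (s', [])

/-- The transition relation `⤳` with insertion errors: the source channel content may be a
(scattered) subword of a content on which `→` fires, and the result may be a superword. -/
def CMStepErr {S M : Type} (C : ChannelMachine S M)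
    (c : S × List M) (l : CMLabel M) (c' : S × List M) : Prop :=
  ∃ x x', CMStep C (c.1, x) l (c'.1, x') ∧ c.2.Sublist x ∧ x'.Sublist c'.2

/-- An error-free computation of `C` (a finite sequence of `→`-steps). -/
structure CMComputation {S M : Type} (C : ChannelMachine S M) where
  len : ℕ
  states : ℕ → S
  chans : ℕ → List M
  labels : ℕ → CMLabel M
  steps : ∀ i < len, CMStep C (states i, chans i) (labels i) (states (i + 1), chans (i + 1))

/-- `max(γ)`: the maximum length of the channel content occurring in `γ`. -/
def CMComputation.maxChan {S M : Type} {C : ChannelMachine S M} (γ : CMComputation C) : ℕ :=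
  (Finset.range (γ.len + 1)).sup fun i => (γ.chans i).length

/-- `γ` is a computation from `(s_I, ε)` to `(s_F, x)` for some `x ∈ M*`. -/
def CMComputation.FromTo {S M : Type} {C : ChannelMachine S M}
    (γ : CMComputation C) (sF : S) : Prop :=
  γ.states 0 = C.init ∧ γ.chans 0 = [] ∧ γ.states γ.len = sF

/-! ### The alphabet `Σ = S ∪ M ∪ L ∪ {#, ⋆}` and the encoding languages `L(C, n)` -/

inductive CMSym (S M : Type) : Type
  | state : S → CMSym S M
  | msg : M → CMSym S M
  | lab : CMLabel M → CMSym S M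
  | hash : CMSym S M
  | star : CMSym S M

instance {S M : Type} : Inhabited (CMSym S M) := ⟨CMSym.hash⟩

/-- Channel-content symbols: elements of `M ∪ {#}`. -/
def CMSym.isContent {S M : Type} : CMSym S M → Prop
  | .msg _ => True
  | .hash => True
  | _ => False

/-- Symbols of `L ∪ {⋆}`. -/
def CMSym.isLabOrStar {S M : Type} : CMSym S M → Prop
  | .lab _ => True
  | .star => True
  | _ => False

/-- The symbol at position `i` of a timed word. -/
def symAt {S M : Type} (w : List (CMSym S M × ℝ)) (i : ℕ) : Option (CMSym S M) :=
  (w[i]?).map Prod.fst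

/-- The timestamp at position `i` of a timed word (junk value `0` out of range). -/
def tAt {S M : Type} (w : List (CMSym S M × ℝ)) (i : ℕ) : ℝ :=
  ((w[i]?).map Prod.snd).getD 0

/-- Some occurrence of the symbol `σ` at time `t` in `w`. -/
def hasAt {S M : Type} (w : List (CMSym S M × ℝ)) (σ : CMSym S M) (t : ℝ) : Prop :=
  ∃ j, j < w.length ∧ symAt w j = some σ ∧ tAt w j = t

/-- The timestamp of the last content symbol of the block `(a, b)`
(the timestamp of the control state symbol if the block is empty). -/
def blockLastTime {S M : Type} (w : List (CMSym S M × ℝ)) (a b : ℕ) : ℝ :=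
  if b = a + 1 then tAt w a else tAt w (b - 1)

/-- The copy/replacement policy on the encoding of channel contents: for every infix
`(s, δ) (σ₁, δ+δ₁) … (σ_m, δ+δ_m) (l, δ+1)` of `w`, the condition determined by the
label `l` holds. -/
def CopyPolicy {S M : Type} (w : List (CMSym S M × ℝ)) : Prop :=
  ∀ a b s l, symAt w a = some (CMSym.state s) → symAt w b = some (CMSym.lab l) →
    a < b → tAt w b = tAt w a + 1 →
    (match l with
     | CMLabel.eps =>
         -- the channel is empty and every `#` is copied two time units later
         (∀ i, a < i → i < b → symAt w i = some CMSym.hash) ∧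
         (∀ i, a < i → i < b → hasAt w CMSym.hash (tAt w i + 2))
     | CMLabel.send m =>
         -- if some `#` occurs in the block, the first one is replaced by `m`
         -- two time units later, all other symbols are copied
         ((∃ j, a < j ∧ j < b ∧ symAt w j = some CMSym.hash) →
            ∃ j, a < j ∧ j < b ∧ symAt w j = some CMSym.hash ∧
              (∀ i, a < i → i < j → ¬ symAt w i = some CMSym.hash) ∧
              hasAt w (CMSym.msg m) (tAt w j + 2) ∧
              (∀ i σ, a < i → i < b → i ≠ j → symAt w i = some σ →
                hasAt w σ (tAt w i + 2))) ∧
         -- otherwise all symbols are copied and a new `m` is inserted at the end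
         -- of the encoding of the next configuration
         ((∀ j, a < j → j < b → ¬ symAt w j = some CMSym.hash) →
            (∀ i σ, a < i → i < b → symAt w i = some σ → hasAt w σ (tAt w i + 2)) ∧
            (∃ k, k < w.length ∧ symAt w k = some (CMSym.msg m) ∧
              blockLastTime w a b + 2 < tAt w k ∧ tAt w k < tAt w a + 3))
     | CMLabel.recv m =>
         -- if the first symbol of the block is `m`, the copies of the remaining symbols
         -- are shifted one position to the right and a new `#` closes the next block
         ((a + 1 < b → symAt w (a + 1) = some (CMSym.msg m) →
            (∀ i σ, a + 1 < i → i < b → symAt w i = some σ →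
              hasAt w σ (tAt w (i - 1) + 2)) ∧
            hasAt w CMSym.hash (tAt w (b - 1) + 2)) ∧
         -- otherwise (insertion error) all symbols are copied and a new `#` is inserted
         -- at the end of the encoding of the next configuration
         (¬ (a + 1 < b ∧ symAt w (a + 1) = some (CMSym.msg m)) →
            (∀ i σ, a < i → i < b → symAt w i = some σ → hasAt w σ (tAt w i + 2)) ∧
            (∃ k, k < w.length ∧ symAt w k = some CMSym.hash ∧
              blockLastTime w a b + 2 < tAt w k ∧ tAt w k < tAt w a + 3))))

/-- The timed language `L(C, n)` of encodings of (possibly faulty) computations of `C`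
from `(s_I, ε)` to `(s_F, x)`, where `n` is the expected maximum length of the
channel content. -/
def CMLang {S M : Type} (C : ChannelMachine S M) (sF : S) (n : ℕ) :
    Set (List (CMSym S M × ℝ)) :=
  { w |
    -- `w` is a strictly monotonic timed word
    w ≠ [] ∧ (∀ e ∈ w, 0 ≤ e.2) ∧ List.Chain' (fun e f : CMSym S M × ℝ => e.2 < f.2) w ∧
    -- every control state symbol `s ≠ s_F` is followed by a label symbol `l` after one
    -- time unit and by a control state symbol `s'` after two time units, with `(s,l,s') ∈ Δ`
    (∀ i s, symAt w i = some (CMSym.state s) → s ≠ sF →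
      ∃ l s', (s, l, s') ∈ C.trans ∧
        hasAt w (CMSym.lab l) (tAt w i + 1) ∧ hasAt w (CMSym.state s') (tAt w i + 2)) ∧
    -- `s_F` is followed by `⋆` after one time unit
    (∀ i, symAt w i = some (CMSym.state sF) → hasAt w CMSym.star (tAt w i + 1)) ∧
    -- control state symbols, label symbols and `⋆` do not occur anywhere else
    (∀ i l, symAt w i = some (CMSym.lab l) →
      ∃ j s, symAt w j = some (CMSym.state s) ∧ s ≠ sF ∧ tAt w i = tAt w j + 1) ∧
    (∀ i, symAt w i = some CMSym.star →
      ∃ j, symAt w j = some (CMSym.state sF) ∧ tAt w i = tAt w j + 1) ∧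
    (∀ i, symAt w i = some CMSym.star → i = w.length - 1) ∧
    (∀ i s, symAt w i = some (CMSym.state s) → i ≠ 0 →
      ∃ j s', symAt w j = some (CMSym.state s') ∧ tAt w i = tAt w j + 2) ∧
    -- symbols of `M ∪ {#}` occur only strictly inside the unit interval following
    -- a control state symbol
    (∀ i σ, symAt w i = some σ → σ.isContent →
      ∃ j s, symAt w j = some (CMSym.state s) ∧ tAt w j < tAt w i ∧ tAt w i < tAt w j + 1) ∧
    -- within a block, `#` occurs only after message symbols
    (∀ i m, ¬ (symAt w i = some CMSym.hash ∧ symAt w (i + 1) = some (CMSym.msg m))) ∧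
    -- the untimed prefix of `w` is `s_I #ⁿ l s`
    (∃ l s rest, w.map Prod.fst =
      CMSym.state C.init ::
        (List.replicate n CMSym.hash ++ CMSym.lab l :: CMSym.state s :: rest)) ∧
    -- `w` contains `s_F`
    (∃ i, symAt w i = some (CMSym.state sF)) ∧
    CopyPolicy w }

/-- `max(w)`: the maximum number of symbols of `M ∪ {#}` occurring in `w` between a
control state symbol and the following symbol of `L ∪ {⋆}`. -/
noncomputable def wordMax {S M : Type} (w : List (CMSym S M × ℝ)) : ℕ :=
  sSup { k | ∃ a b, a < b ∧ b < w.length ∧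
    (∃ s, symAt w a = some (CMSym.state s)) ∧
    (∃ σ, symAt w b = some σ ∧ σ.isLabOrStar) ∧
    (∀ i, a < i → i < b → ∃ σ, symAt w i = some σ ∧ σ.isContent) ∧
    k = b - a - 1 }

/-- The canonical block form
`(s₀,δ) · w₁ · (l₁,δ+1) (s₁,δ+2) · w₂ · (l₂,δ+3) … (s_F, …) · w_N · (⋆, …)`
of a timed word (blocks are numbered `0, …, N-1` here). -/
structure BlockForm {S M : Type} (C : ChannelMachine S M) (sF : S)
    (w : List (CMSym S M × ℝ)) where
  N : ℕ
  Npos : 0 < N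
  δ : ℝ
  δnonneg : 0 ≤ δ
  states : ℕ → S
  labs : ℕ → CMLabel M
  nsz : ℕ → ℕ
  syms : ℕ → ℕ → CMSym S M
  offs : ℕ → ℕ → ℝ
  start : states 0 = C.init
  last : states (N - 1) = sF
  offs_pos : ∀ i < N, ∀ j < nsz i, 0 < offs i j
  offs_lt_one : ∀ i < N, ∀ j < nsz i, offs i j < 1
  offs_mono : ∀ i < N, ∀ j k, j < k → k < nsz i → offs i j < offs i k
  syms_content : ∀ i < N, ∀ j < nsz i, (syms i j).isContent
  eq : w = ((List.range N).map fun i =>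
      (CMSym.state (states i), δ + 2 * (i : ℝ)) ::
        (((List.range (nsz i)).map fun j => (syms i j, δ + 2 * (i : ℝ) + offs i j)) ++
          [(if i = N - 1 then CMSym.star else CMSym.lab (labs i), δ + 2 * (i : ℝ) + 1)])).flatten

/-! ### The parametric timed automaton `A_C` -/

/-- The clock constraint `x = p`. -/
def guardEqP : ClockConstraint Unit Unit := [⟨(), Cmp.eq, Sum.inr ()⟩]

/-- The deterministic one-clock one-parameter automaton `A_C` excluding insertion errors. -/
def AC {S M : Type} (C : ChannelMachine S M) (sF : S) :
    PTA (CMSym S M) Unit Unit (Fin 5) where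
  init := {0}
  final := {4}
  edges := { e |
    e = (0, CMSym.state C.init, ([] : ClockConstraint Unit Unit), Set.univ, 1) ∨
    e = (1, CMSym.hash, guardEqP, Set.univ, 1) ∨
    (∃ l : CMLabel M, e = (1, CMSym.lab l, guardEqP, (∅ : Set Unit), 2)) ∨
    (∃ a : CMSym S M, a ≠ CMSym.state sF ∧
      e = (2, a, ([] : ClockConstraint Unit Unit), (∅ : Set Unit), 2)) ∨
    e = (2, CMSym.state sF, ([] : ClockConstraint Unit Unit), Set.univ, 3) ∨
    (∃ σ : CMSym S M, σ.isContent ∧ e = (3, σ, guardEqP, Set.univ, 3)) ∨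
    e = (3, CMSym.star, guardEqP, (∅ : Set Unit), 4) }

/-! ### The MTL formula `φ_C` -/

def allLabels (M : Type) [Fintype M] : List (CMLabel M) :=
  CMLabel.eps ::
    ((Finset.univ : Finset M).toList.map CMLabel.send ++
     (Finset.univ : Finset M).toList.map CMLabel.recv)

/-- `⋁ S`. -/
def orStates (S M : Type) [Fintype S] : MTL (CMSym S M) :=
  MTL.bigOr ((Finset.univ : Finset S).toList.map fun s => MTL.atom (CMSym.state s))

/-- `⋁ M`. -/
def orMsgs (S M : Type) [Fintype M] : MTL (CMSym S M) :=
  MTL.bigOr ((Finset.univ : Finset M).toList.map fun m => MTL.atom (CMSym.msg m))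

/-- `⋁ L`. -/
def orLabs (S M : Type) [Fintype M] : MTL (CMSym S M) :=
  MTL.bigOr ((allLabels M).map fun l => MTL.atom (CMSym.lab l))

/-- `φ_copyM = G_{(0,1)} ⋀_{m ∈ M} (m → F_{=2} m)`. -/
def phiCopyM (S M : Type) [Fintype M] : MTL (CMSym S M) :=
  MTL.G (MTLInterval.ooI 0 1)
    (MTL.bigAnd ((Finset.univ : Finset M).toList.map fun m =>
      MTL.imp (MTL.atom (CMSym.msg m)) (MTL.F (MTLInterval.exactly 2) (MTL.atom (CMSym.msg m)))))

/-- `φ_copy# = G_{(0,1)} (# → F_{=2} #)`. -/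
def phiCopyHash (S M : Type) : MTL (CMSym S M) :=
  MTL.G (MTLInterval.ooI 0 1)
    (MTL.imp (MTL.atom CMSym.hash) (MTL.F (MTLInterval.exactly 2) (MTL.atom CMSym.hash)))

/-- `G (X_{>0} ⊤ ∨ ¬ X ⊤)` (strict monotonicity). -/
def phiMono (S M : Type) : MTL (CMSym S M) :=
  MTL.G MTLInterval.full
    (MTL.or (MTL.X MTLInterval.pos MTL.tt) (MTL.not (MTL.X MTLInterval.full MTL.tt)))

/-- `G [⋀_{s ≠ s_F} (s → ⋁_{(s,l,s') ∈ Δ} (F_{=1} l ∧ F_{=2} s')) ∧ (s_F → F_{=1} ⋆)]`. -/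
def phiStates {S M : Type} [Fintype S] [DecidableEq S]
    (C : ChannelMachine S M) (sF : S) : MTL (CMSym S M) :=
  MTL.G MTLInterval.full
    (MTL.and
      (MTL.bigAnd (((Finset.univ : Finset S).toList.filter fun s => decide (s ≠ sF)).map fun s =>
        MTL.imp (MTL.atom (CMSym.state s))
          (MTL.bigOr (C.trans.toList.filterMap fun tr =>
            if tr.1 = s then
              some (MTL.and (MTL.F (MTLInterval.exactly 1) (MTL.atom (CMSym.lab tr.2.1)))
                            (MTL.F (MTLInterval.exactly 2) (MTL.atom (CMSym.state tr.2.2))))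
            else none))))
      (MTL.imp (MTL.atom (CMSym.state sF)) (MTL.F (MTLInterval.exactly 1) (MTL.atom CMSym.star))))

/-- `G [⋁S → (G_{<2} ¬⋁S ∧ G_{(0,1) ∪ (1,2)} ¬⋁L)]`. -/
def phiPlacement (S M : Type) [Fintype S] [Fintype M] : MTL (CMSym S M) :=
  MTL.G MTLInterval.full
    (MTL.imp (orStates S M)
      (MTL.and (MTL.G (MTLInterval.ltI 2) (MTL.not (orStates S M)))
        (MTL.and (MTL.G (MTLInterval.ooI 0 1) (MTL.not (orLabs S M)))
                 (MTL.G (MTLInterval.ooI 1 2) (MTL.not (orLabs S M))))))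

/-- `G [⋁S → (G_{(0,1)} (⋁M ∨ #) ∧ G_{[1,2)} ¬(⋁M ∨ #))]`. -/
def phiContent (S M : Type) [Fintype S] [Fintype M] : MTL (CMSym S M) :=
  MTL.G MTLInterval.full
    (MTL.imp (orStates S M)
      (MTL.and (MTL.G (MTLInterval.ooI 0 1) (MTL.or (orMsgs S M) (MTL.atom CMSym.hash)))
        (MTL.G (MTLInterval.coI 1 2) (MTL.not (MTL.or (orMsgs S M) (MTL.atom CMSym.hash))))))

/-- `G ((# ∧ X ⋁M) → ⊥)`. -/
def phiHashMsg (S M : Type) [Fintype M] : MTL (CMSym S M) :=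
  MTL.G MTLInterval.full
    (MTL.imp (MTL.and (MTL.atom CMSym.hash) (MTL.X MTLInterval.full (orMsgs S M))) MTL.ff)

/-- `s_I ∧ ⋁_{(s_I,l,s) ∈ Δ} (# U (l ∧ X s))`. -/
def phiInit {S M : Type} [DecidableEq S] (C : ChannelMachine S M) : MTL (CMSym S M) :=
  MTL.and (MTL.atom (CMSym.state C.init))
    (MTL.bigOr (C.trans.toList.filterMap fun tr =>
      if tr.1 = C.init then
        some (MTL.untl (MTL.atom CMSym.hash)
          (MTL.and (MTL.atom (CMSym.lab tr.2.1))
            (MTL.X MTLInterval.full (MTL.atom (CMSym.state tr.2.2))))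
          MTLInterval.full)
      else none))

/-- `G ⋀_{(s,ε,·) ∈ Δ, s ≠ s_F} ((s ∧ F_{=1} ε) → (G_{(0,1)} ¬⋁M ∧ φ_copy#))`. -/
def phiEps {S M : Type} [Fintype M] [DecidableEq S]
    (C : ChannelMachine S M) (sF : S) : MTL (CMSym S M) :=
  MTL.G MTLInterval.full
    (MTL.bigAnd (C.trans.toList.filterMap fun tr =>
      match tr with
      | (s, CMLabel.eps, _) =>
        if s = sF then none else
          some (MTL.imp (MTL.and (MTL.atom (CMSym.state s))
              (MTL.F (MTLInterval.exactly 1) (MTL.atom (CMSym.lab CMLabel.eps))))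
            (MTL.and (MTL.G (MTLInterval.ooI 0 1) (MTL.not (orMsgs S M))) (phiCopyHash S M)))
      | _ => none))

/-- `φ_next# = X# → (X F_{=2} m ∧ X φ_copy#)`. -/
def phiNextHash (S M : Type) (m : M) : MTL (CMSym S M) :=
  MTL.imp (MTL.X MTLInterval.full (MTL.atom CMSym.hash))
    (MTL.and (MTL.X MTLInterval.full (MTL.F (MTLInterval.exactly 2) (MTL.atom (CMSym.msg m))))
             (MTL.X MTLInterval.full (phiCopyHash S M)))

/-- `φ_yes# = (F_{<1}# ∧ ¬X#) → G_{<1} ((¬# ∧ X#) → (X F_{=2} m ∧ X φ_copy#))`. -/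
def phiYesHash (S M : Type) (m : M) : MTL (CMSym S M) :=
  MTL.imp (MTL.and (MTL.F (MTLInterval.ltI 1) (MTL.atom CMSym.hash))
                   (MTL.not (MTL.X MTLInterval.full (MTL.atom CMSym.hash))))
    (MTL.G (MTLInterval.ltI 1)
      (MTL.imp (MTL.and (MTL.not (MTL.atom CMSym.hash))
                        (MTL.X MTLInterval.full (MTL.atom CMSym.hash)))
        (MTL.and (MTL.X MTLInterval.full (MTL.F (MTLInterval.exactly 2) (MTL.atom (CMSym.msg m))))
                 (MTL.X MTLInterval.full (phiCopyHash S M)))))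

/-- `φ_no# = ¬F_{<1}# → G_{<1} (X m! → F_{=2} (X m ∧ X X ⋁L))`. -/
def phiNoHash (S M : Type) [Fintype M] (m : M) : MTL (CMSym S M) :=
  MTL.imp (MTL.not (MTL.F (MTLInterval.ltI 1) (MTL.atom CMSym.hash)))
    (MTL.G (MTLInterval.ltI 1)
      (MTL.imp (MTL.X MTLInterval.full (MTL.atom (CMSym.lab (CMLabel.send m))))
        (MTL.F (MTLInterval.exactly 2)
          (MTL.and (MTL.X MTLInterval.full (MTL.atom (CMSym.msg m)))
                   (MTL.X MTLInterval.full (MTL.X MTLInterval.full (orLabs S M)))))))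

/-- `G ⋀_{(s,m!,·) ∈ Δ, s ≠ s_F} ((s ∧ F_{=1} m!) → (φ_copyM ∧ φ_next# ∧ φ_yes# ∧ φ_no#))`. -/
def phiSend {S M : Type} [Fintype M] [DecidableEq S]
    (C : ChannelMachine S M) (sF : S) : MTL (CMSym S M) :=
  MTL.G MTLInterval.full
    (MTL.bigAnd (C.trans.toList.filterMap fun tr =>
      match tr with
      | (s, CMLabel.send m, _) =>
        if s = sF then none else
          some (MTL.imp (MTL.and (MTL.atom (CMSym.state s))
              (MTL.F (MTLInterval.exactly 1) (MTL.atom (CMSym.lab (CMLabel.send m)))))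
            (MTL.and (phiCopyM S M)
              (MTL.and (phiNextHash S M m) (MTL.and (phiYesHash S M m) (phiNoHash S M m)))))
      | _ => none))

/-- `φ_shift = ⋀_{m' ∈ M} (X m' → F_{=2} m') ∧ (X# → F_{=2}#) ∧ (X m? → F_{=2}#)`. -/
def phiShift (S M : Type) [Fintype M] (m : M) : MTL (CMSym S M) :=
  MTL.and
    (MTL.bigAnd ((Finset.univ : Finset M).toList.map fun m' =>
      MTL.imp (MTL.X MTLInterval.full (MTL.atom (CMSym.msg m')))
              (MTL.F (MTLInterval.exactly 2) (MTL.atom (CMSym.msg m')))))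
    (MTL.and
      (MTL.imp (MTL.X MTLInterval.full (MTL.atom CMSym.hash))
               (MTL.F (MTLInterval.exactly 2) (MTL.atom CMSym.hash)))
      (MTL.imp (MTL.X MTLInterval.full (MTL.atom (CMSym.lab (CMLabel.recv m))))
               (MTL.F (MTLInterval.exactly 2) (MTL.atom CMSym.hash))))

/-- `φ_yesm = X m → (φ_shift U m?)`. -/
def phiYesM (S M : Type) [Fintype M] (m : M) : MTL (CMSym S M) :=
  MTL.imp (MTL.X MTLInterval.full (MTL.atom (CMSym.msg m)))
    (MTL.untl (phiShift S M m) (MTL.atom (CMSym.lab (CMLabel.recv m))) MTLInterval.full)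

/-- `φ_nom = X ¬m → (φ_copyM ∧ φ_copy# ∧ G_{<1} (X m? → F_{=2} (X# ∧ X X ⋁L)))`. -/
def phiNoM (S M : Type) [Fintype M] (m : M) : MTL (CMSym S M) :=
  MTL.imp (MTL.X MTLInterval.full (MTL.not (MTL.atom (CMSym.msg m))))
    (MTL.and (phiCopyM S M) (MTL.and (phiCopyHash S M)
      (MTL.G (MTLInterval.ltI 1)
        (MTL.imp (MTL.X MTLInterval.full (MTL.atom (CMSym.lab (CMLabel.recv m))))
          (MTL.F (MTLInterval.exactly 2)
            (MTL.and (MTL.X MTLInterval.full (MTL.atom CMSym.hash))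
                     (MTL.X MTLInterval.full (MTL.X MTLInterval.full (orLabs S M)))))))))

/-- `G ⋀_{(s,m?,·) ∈ Δ, s ≠ s_F} ((s ∧ F_{=1} m?) → (φ_yesm ∧ φ_nom))`. -/
def phiRecv {S M : Type} [Fintype M] [DecidableEq S]
    (C : ChannelMachine S M) (sF : S) : MTL (CMSym S M) :=
  MTL.G MTLInterval.full
    (MTL.bigAnd (C.trans.toList.filterMap fun tr =>
      match tr with
      | (s, CMLabel.recv m, _) =>
        if s = sF then none else
          some (MTL.imp (MTL.and (MTL.atom (CMSym.state s))
              (MTL.F (MTLInterval.exactly 1) (MTL.atom (CMSym.lab (CMLabel.recv m)))))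
            (MTL.and (phiYesM S M m) (phiNoM S M m)))
      | _ => none))

/-- The MTL formula `φ_C` with `L(φ_C) = L(C)`. -/
def phiC {S M : Type} [Fintype S] [DecidableEq S] [Fintype M] [DecidableEq M]
    (C : ChannelMachine S M) (sF : S) : MTL (CMSym S M) :=
  MTL.bigAnd
    [phiMono S M, phiStates C sF, phiPlacement S M, phiContent S M, phiHashMsg S M,
     phiInit C, MTL.F MTLInterval.full (MTL.atom (CMSym.state sF)),
     phiEps C sF, phiSend C sF, phiRecv C sF]

/-- Every position of a block ended by a label has some event two time units later. -/
theorem CopyPolicy.event_two_later {S M : Type} {w : List (CMSym S M × ℝ)} (h : CopyPolicy w)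
    {a b : ℕ} {s : S} {l : CMLabel M} (ha : symAt w a = some (CMSym.state s))
    (hb : symAt w b = some (CMSym.lab l)) (hab : a < b) (ht : tAt w b = tAt w a + 1)
    (hdef : ∀ q, q < b → ∃ σ, symAt w q = some σ)
    {q : ℕ} (haq : a < q) (hqb : q < b) : ∃ σ, hasAt w σ (tAt w q + 2) := by
  have H := h a b s l ha hb hab ht
  cases l with
  | eps => exact ⟨_, H.2 q haq hqb⟩
  | send m =>
    obtain ⟨H1, H2⟩ := H
    obtain ⟨σ, hσ⟩ := hdef q hqb
    by_cases hx : ∃ j, a < j ∧ j < b ∧ symAt w j = some CMSym.hash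
    · obtain ⟨j, _, _, _, _, hm, hc⟩ := H1 hx
      by_cases hqj : q = j
      · subst hqj
        exact ⟨_, hm⟩
      · exact ⟨_, hc q σ haq hqb hqj hσ⟩
    · have := (H2 (fun j h1 h2 h3 => hx ⟨j, h1, h2, h3⟩)).1
      exact ⟨_, this q σ haq hqb hσ⟩
  | recv m =>
    obtain ⟨H1, H2⟩ := H
    by_cases hx : a + 1 < b ∧ symAt w (a + 1) = some (CMSym.msg m)
    · obtain ⟨h1, h2⟩ := H1 hx.1 hx.2
      by_cases hq : q + 1 < b
      · obtain ⟨σ, hσ⟩ := hdef (q + 1) hq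
        have := h1 (q + 1) σ (by omega) hq hσ
        exact ⟨σ, by simpa using this⟩
      · have e : b - 1 = q := by omega
        rw [e] at h2
        exact ⟨_, h2⟩
    · obtain ⟨σ, hσ⟩ := hdef q hqb
      exact ⟨_, (H2 hx).1 q σ haq hqb hσ⟩

/-- Indexing into the middle part of a word. -/
theorem getElem?_middle {α : Type} (p u v : List α) (k : ℕ) (hk : k < u.length) :
    (p ++ (u ++ v))[p.length + k]? = u[k]? := by
  rw [List.getElem?_append_right (by omega), Nat.add_sub_cancel_left,
    List.getElem?_append_left hk]

/-- For `w ∈ L(C,n)` in canonical block form, the fractional offsets of each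
block embed, via a strictly increasing function, into those of the next block. -/
theorem blockForm_offsets_embed
    {S M : Type} [Fintype S] [DecidableEq S] [Fintype M] [DecidableEq M]
    (C : ChannelMachine S M) (sF : S) (n : ℕ)
    (w : List (CMSym S M × ℝ)) (hw : w ∈ CMLang C sF n)
    (bf : BlockForm C sF w) (hn : bf.nsz 0 = n) :
    ∀ i, i + 1 < bf.N →
      ∃ f : Fin (bf.nsz i) → Fin (bf.nsz (i + 1)),
        StrictMono f ∧ ∀ j : Fin (bf.nsz i), bf.offs i j = bf.offs (i + 1) (f j) := by
  intro i hi
  have hcp : CopyPolicy w := hw.2.2.2.2.2.2.2.2.2.2.2.2.2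
  have key : ∀ j : Fin (bf.nsz i), ∃ k : Fin (bf.nsz (i + 1)),
      bf.offs i j = bf.offs (i + 1) k := by
    rintro ⟨j, hj⟩
    have hpos := bf.offs_pos i (by omega) j hj
    have hlt := bf.offs_lt_one i (by omega) j hj
    -- an event at the shifted time
    have hev : ∃ σ, hasAt w σ (bf.δ + 2 * (i : ℝ) + bf.offs i j + 2) := by
      have hEq := bf.eq
      set g : ℕ → List (CMSym S M × ℝ) := fun i =>
        (CMSym.state (bf.states i), bf.δ + 2 * (i : ℝ)) ::
        (((List.range (bf.nsz i)).map fun j =>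
            (bf.syms i j, bf.δ + 2 * (i : ℝ) + bf.offs i j)) ++
          [(if i = bf.N - 1 then CMSym.star else CMSym.lab (bf.labs i),
            bf.δ + 2 * (i : ℝ) + 1)]) with hg
      have hmem : g i ∈ (List.range bf.N).map g :=
        List.mem_map_of_mem (List.mem_range.2 (by omega))
      obtain ⟨s, t, hst⟩ := List.append_of_mem hmem
      rw [hst, List.flatten_append, List.flatten_cons] at hEq
      have hlen : (g i).length = bf.nsz i + 2 := by simp [hg]
      have hget : ∀ k, k < bf.nsz i + 2 → w[s.flatten.length + k]? = (g i)[k]? := by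
        intro k hk
        rw [hEq]
        exact getElem?_middle _ _ _ _ (by omega)
      have h0 := hget 0 (by omega)
      have h1 := hget (bf.nsz i + 1) (by omega)
      have h2 := hget (j + 1) (by omega)
      have e0 : (g i)[0]? = some (CMSym.state (bf.states i), bf.δ + 2 * (i : ℝ)) := by
        simp [hg]
      have e1 : (g i)[bf.nsz i + 1]? =
          some (CMSym.lab (bf.labs i), bf.δ + 2 * (i : ℝ) + 1) := by
        have : i ≠ bf.N - 1 := by omega
        simp [hg, this]
      have e2 : (g i)[j + 1]? = some (bf.syms i j, bf.δ + 2 * (i : ℝ) + bf.offs i j) := by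
        simp [hg, List.getElem?_append_left, hj]
      rw [e0] at h0
      rw [e1] at h1
      rw [e2] at h2
      have hwl : s.flatten.length + (bf.nsz i + 2) ≤ w.length := by
        have hL := congrArg List.length hEq
        simp only [List.length_append, hlen] at hL
        omega
      have := hcp.event_two_later (a := s.flatten.length + 0)
        (b := s.flatten.length + (bf.nsz i + 1)) (q := s.flatten.length + (j + 1))
        (s := bf.states i) (l := bf.labs i)
        (by simp only [symAt, h0, Option.map_some]) (by simp only [symAt, h1, Option.map_some])
        (by omega) (by simp only [tAt, h0, h1, Option.map_some, Option.getD_some])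
        (by
          intro q hq
          have hq' : q < w.length := by omega
          exact ⟨_, by simp only [symAt, List.getElem?_eq_getElem hq', Option.map_some]; rfl⟩)
        (by omega) (by omega)
      simpa only [tAt, h2, Option.map_some, Option.getD_some] using this
    obtain ⟨σ, q, hq, -, ht⟩ := hev
    simp only [tAt, List.getElem?_eq_getElem hq, Option.map_some, Option.getD_some] at ht
    have hm : w[q] ∈ w := List.getElem_mem hq
    generalize w[q] = e at ht hm
    rw [bf.eq] at hm
    simp only [List.mem_flatten, List.mem_map, List.mem_range] at hm
    obtain ⟨_, ⟨i', hi', rfl⟩, he⟩ := hm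
    simp only [List.mem_cons, List.mem_append, List.mem_map, List.mem_range,
      List.not_mem_nil, or_false] at he
    rcases he with rfl | ⟨k, hk, rfl⟩ | rfl
    · exfalso
      simp only at ht
      have a1 : ((i : ℤ) : ℝ) + 1 < ((i' : ℤ) : ℝ) := by push_cast; linarith
      have a2 : ((i' : ℤ) : ℝ) < ((i : ℤ) : ℝ) + 2 := by push_cast; linarith
      norm_cast at a1 a2
      omega
    · simp only at ht
      have p1 := bf.offs_pos i' hi' k hk
      have p2 := bf.offs_lt_one i' hi' k hk
      have a1 : ((i : ℤ) : ℝ) < ((i' : ℤ) : ℝ) := by push_cast; linarith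
      have a2 : ((i' : ℤ) : ℝ) < ((i : ℤ) : ℝ) + 2 := by push_cast; linarith
      norm_cast at a1 a2
      have : i' = i + 1 := by omega
      subst this
      refine ⟨⟨k, hk⟩, ?_⟩
      push_cast at ht
      simp only
      linarith
    · exfalso
      simp only at ht
      have a1 : 2 * ((i : ℤ) : ℝ) + 1 < 2 * ((i' : ℤ) : ℝ) := by push_cast; linarith
      have a2 : 2 * ((i' : ℤ) : ℝ) < 2 * ((i : ℤ) : ℝ) + 2 := by push_cast; linarith
      norm_cast at a1 a2
      omega
  choose f hf using key
  refine ⟨f, ?_, hf⟩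
  intro j k hjk
  by_contra hcon
  have h1 := bf.offs_mono i (by omega) j k hjk k.2
  rw [hf j, hf k] at h1
  rcases (not_lt.1 hcon).lt_or_eq with h | h
  · have := bf.offs_mono (i + 1) hi (f k) (f j) h (f j).2
    linarith
  · rw [h] at h1
    exact lt_irrefl _ h1
end
end

section
/- For every n ∈ ℕ and every timed word w ∈ L(C, n) with max(w) = n, there exists an error-free computation γ of the channel machine C from (s_I, ε) to (s_F, x) for some x ∈ M*, with max(γ) ≤ n. -/
open scoped NNRat

noncomputable section

theorem symAt_lt {S M : Type} {w : List (CMSym S M × ℝ)} {i : ℕ} {σ : CMSym S M}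
    (h : symAt w i = some σ) : i < w.length := by
  unfold symAt at h
  by_contra hc
  rw [List.getElem?_eq_none (by omega)] at h
  simp at h

theorem symAt_some {S M : Type} {w : List (CMSym S M × ℝ)} {i : ℕ}
    (h : i < w.length) : ∃ σ, symAt w i = some σ := by
  unfold symAt
  rw [List.getElem?_eq_getElem h]
  exact ⟨_, rfl⟩

theorem tAt_strict {S M : Type} {w : List (CMSym S M × ℝ)}
    (h : List.Chain' (fun e f : CMSym S M × ℝ => e.2 < f.2) w) {i j : ℕ}
    (hij : i < j) (hj : j < w.length) : tAt w i < tAt w j := by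
  have hp : w.Pairwise (fun e f : CMSym S M × ℝ => e.2 < f.2) := by
    have : IsTrans (CMSym S M × ℝ) (fun e f : CMSym S M × ℝ => e.2 < f.2) :=
      ⟨fun a b c h1 h2 => lt_trans h1 h2⟩
    exact List.isChain_iff_pairwise.1 h
  have := List.pairwise_iff_getElem.1 hp i j (by omega) hj hij
  unfold tAt
  rw [List.getElem?_eq_getElem hj, List.getElem?_eq_getElem (by omega)]
  simpa using this

/-- Strictly monotone times on positions below `len`. -/
def SM (t : ℕ → ℝ) (len : ℕ) : Prop := ∀ i j, i < j → j < len → t i < t j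

theorem SM.lt_of {t : ℕ → ℝ} {len : ℕ} (h : SM t len) {i j : ℕ} (hi : i < len)
    (hij : t i < t j) : i < j := by
  by_contra hc
  rcases Nat.lt_or_ge j i with h1 | h1
  · have := h j i h1 hi; linarith
  · have : i = j := by omega
    subst this; linarith

theorem SM.inj {t : ℕ → ℝ} {len : ℕ} (h : SM t len) {i j : ℕ} (hi : i < len) (hj : j < len)
    (hij : t i = t j) : i = j := by
  rcases lt_trichotomy i j with h1 | h1 | h1
  · have := h i j h1 hj; linarith
  · exact h1
  · have := h j i h1 hi; linarith

/-- Rigidity of copying. -/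
theorem rigid {t : ℕ → ℝ} {len : ℕ} (h : SM t len) {n a a' b' : ℕ}
    (hb : a + n + 1 < len) (hb' : b' < len) (hab' : a' < b') (hn : b' ≤ a' + n + 1)
    (ha' : t a' = t a + 2) (ht : t (a + n + 1) = t a + 1) (ht' : t b' = t a' + 1)
    (hc : ∀ i < n, ∃ j < len, t j = t (a + 1 + i) + 2) :
    b' = a' + n + 1 ∧ ∀ i ≤ n, t (a' + i) = t (a + i) + 2 := by
  have hc' : ∀ i, ∃ j, i ≤ n + 1 → j < len ∧ (i ≤ n → t j = t (a + i) + 2) ∧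
      (i = 0 → j = a') ∧ (i = n + 1 → j = b') := by
    intro i
    rcases Nat.eq_zero_or_pos i with h0 | h0
    · subst h0
      exact ⟨a', fun _ => ⟨by omega, fun _ => by simpa using ha', fun _ => rfl, by omega⟩⟩
    · by_cases h1 : i ≤ n
      · obtain ⟨j, hj, hj'⟩ := hc (i - 1) (by omega)
        refine ⟨j, fun _ => ⟨hj, fun _ => ?_, by omega, by omega⟩⟩
        rw [hj', show a + 1 + (i - 1) = a + i by omega]
      · exact ⟨b', fun _ => ⟨hb', by omega, by omega, fun _ => rfl⟩⟩
  choose f hf using hc'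
  have hstep : ∀ i ≤ n, f i < f (i + 1) := by
    intro i hi
    obtain ⟨h1, h2, _, _⟩ := hf i (by omega)
    obtain ⟨h3, h4, _, h5⟩ := hf (i + 1) (by omega)
    apply h.lt_of h1
    rw [h2 hi]
    by_cases hi' : i + 1 ≤ n
    · rw [h4 hi']
      have := h (a + i) (a + (i + 1)) (by omega) (by omega)
      linarith
    · have hin : i = n := by omega
      rw [h5 (by omega), ht', ha', hin]
      have := h (a + n) (a + n + 1) (by omega) (by omega)
      linarith
  have h0 : f 0 = a' := (hf 0 (by omega)).2.2.1 rfl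
  have hN : f (n + 1) = b' := (hf (n + 1) (by omega)).2.2.2 rfl
  have hlow : ∀ i ≤ n + 1, a' + i ≤ f i := by
    intro i
    induction i with
    | zero => intro _; omega
    | succ k ih => intro hk; have := hstep k (by omega); have := ih (by omega); omega
  have hup : ∀ d ≤ n + 1, f (n + 1 - d) + d ≤ b' := by
    intro d
    induction d with
    | zero => intro _; simp [hN]
    | succ k ih =>
      intro hk
      have h1 := hstep (n + 1 - (k + 1)) (by omega)
      rw [show n + 1 - (k + 1) + 1 = n + 1 - k by omega] at h1
      have := ih (by omega); omega
  have hbe : b' = a' + n + 1 := by have := hlow (n + 1) le_rfl; omega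
  refine ⟨hbe, fun i hi => ?_⟩
  have h1 := hlow i (by omega)
  have h2 := hup (n + 1 - i) (by omega)
  rw [show n + 1 - (n + 1 - i) = i by omega] at h2
  have : f i = a' + i := by omega
  rw [← this]
  exact (hf i (by omega)).2.1 hi

/-- Prepending a step to a computation. -/
theorem cons_comp {S M : Type} (C : ChannelMachine S M) (sF : S) (n : ℕ) {s s' : S}
    {x x' : List M} {l : CMLabel M} (hs : CMStep C (s, x) l (s', x')) (hx : x.length ≤ n)
    (h : ∃ γ : CMComputation C, γ.states 0 = s' ∧ γ.chans 0 = x' ∧ γ.states γ.len = sF ∧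
      γ.maxChan ≤ n) :
    ∃ γ : CMComputation C, γ.states 0 = s ∧ γ.chans 0 = x ∧ γ.states γ.len = sF ∧
      γ.maxChan ≤ n := by
  obtain ⟨γ, h1, h2, h3, h4⟩ := h
  refine ⟨⟨γ.len + 1, fun i => Nat.casesOn i s γ.states, fun i => Nat.casesOn i x γ.chans,
    fun i => Nat.casesOn i l γ.labels, ?_⟩, rfl, rfl, h3, ?_⟩
  · intro i hi
    cases i with
    | zero => simpa [h1, h2] using hs
    | succ k => exact γ.steps k (by omega)
  · unfold CMComputation.maxChan at h4 ⊢
    rw [Finset.sup_le_iff] at h4 ⊢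
    intro i hi
    cases i with
    | zero => exact hx
    | succ k => exact h4 k (by simp at hi ⊢; omega)

/-- Block invariant. -/
structure BInv {S M : Type} (w : List (CMSym S M × ℝ)) (n a : ℕ) (s : S) (x : List M) :
    Prop where
  st : symAt w a = some (CMSym.state s)
  hb : a + n + 1 < w.length
  ht : tAt w (a + n + 1) = tAt w a + 1
  hx : x.length ≤ n
  cont : ∀ i < n, symAt w (a + 1 + i) = some ((x[i]?).elim CMSym.hash CMSym.msg)

/-- For every `n ∈ ℕ` and every `w ∈ L(C, n)` with `max(w) = n`, there exists
an error-free computation `γ` of `C` from `(s_I, ε)` to `(s_F, x)` for some `x ∈ M*`,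
with `max(γ) ≤ n`. -/
theorem word_to_errorFree_computation
    {S M : Type} [Fintype S] [DecidableEq S] [Fintype M] [DecidableEq M]
    (C : ChannelMachine S M) (sF : S)
    (n : ℕ) (w : List (CMSym S M × ℝ)) (hw : w ∈ CMLang C sF n) (hmax : wordMax w = n) :
    ∃ γ : CMComputation C, γ.FromTo sF ∧ γ.maxChan ≤ n := by
  obtain ⟨hne, -, hch, hst, hsF, hlab, hstar, -, hpred, -, -, hpre, -, hpol⟩ := hw
  have hsm : SM (tAt w) w.length := fun i j hij hj => tAt_strict hch hij hj
  -- state times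
  have htimes : ∀ i s, symAt w i = some (CMSym.state s) → ∃ k : ℕ, tAt w i = tAt w 0 + 2 * k := by
    intro i
    induction i using Nat.strong_induction_on with
    | _ i ih =>
      intro s hs
      by_cases hi : i = 0
      · exact ⟨0, by simp [hi]⟩
      · obtain ⟨j, s', hj, hij⟩ := hpred i s hs hi
        obtain ⟨k, hk⟩ := ih j (hsm.lt_of (symAt_lt hj) (by linarith)) s' hj
        exact ⟨k + 1, by push_cast; linarith⟩
  -- end of blocks
  have hend : ∀ a s, symAt w a = some (CMSym.state s) → ∃ b, b < w.length ∧
      (∃ σ, symAt w b = some σ ∧ σ.isLabOrStar) ∧ tAt w b = tAt w a + 1 := by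
    intro a s hs
    by_cases h : s = sF
    · subst h
      obtain ⟨b, hb, h1, h2⟩ := hsF a hs
      exact ⟨b, hb, ⟨_, h1, trivial⟩, h2⟩
    · obtain ⟨l, s', _, ⟨b, hb, h1, h2⟩, _⟩ := hst a s hs h
      exact ⟨b, hb, ⟨_, h1, trivial⟩, h2⟩
  -- content between
  have hcont : ∀ a b s, symAt w a = some (CMSym.state s) → b < w.length →
      tAt w b = tAt w a + 1 → ∀ i, a < i → i < b → ∃ σ, symAt w i = some σ ∧ σ.isContent := by
    intro a b s hs hb hab i hai hib
    obtain ⟨σ, hσ⟩ := symAt_some (w := w) (i := i) (by omega)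
    refine ⟨σ, hσ, ?_⟩
    obtain ⟨k, hk⟩ := htimes a s hs
    have t1 := hsm a i hai (by omega)
    have t2 := hsm i b hib hb
    have key : ∀ k' : ℕ, (tAt w i = tAt w 0 + 2 * k' ∨ tAt w i = tAt w 0 + 2 * k' + 1) →
        False := by
      intro k' hk'
      rcases hk' with hk' | hk'
      · have e1 : (k : ℝ) < k' := by linarith
        have e2 : (2 * k' : ℝ) < 2 * k + 1 := by linarith
        norm_cast at e1 e2
        omega
      · have e1 : (2 * k : ℝ) < 2 * k' + 1 := by linarith
        have e2 : (k' : ℝ) < k := by linarith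
        norm_cast at e1 e2
        omega
    cases σ with
    | msg m => trivial
    | hash => trivial
    | state s' =>
      obtain ⟨k', hk'⟩ := htimes i s' hσ
      exact (key k' (Or.inl hk')).elim
    | lab l =>
      obtain ⟨j, s', hj, _, h2⟩ := hlab i l hσ
      obtain ⟨k', hk'⟩ := htimes j s' hj
      exact (key k' (Or.inr (by linarith))).elim
    | star =>
      obtain ⟨j, hj, h2⟩ := hstar i hσ
      obtain ⟨k', hk'⟩ := htimes j sF hj
      exact (key k' (Or.inr (by linarith))).elim
  -- size bound
  have hsize : ∀ a b s, symAt w a = some (CMSym.state s) → b < w.length →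
      (∃ σ, symAt w b = some σ ∧ σ.isLabOrStar) → tAt w b = tAt w a + 1 →
      a < b ∧ b ≤ a + n + 1 := by
    intro a b s hs hb hσ hab
    have hlt : a < b := hsm.lt_of (symAt_lt hs) (by linarith)
    refine ⟨hlt, ?_⟩
    have : b - a - 1 ≤ wordMax w := by
      apply le_csSup
      · refine ⟨w.length, ?_⟩
        rintro k ⟨a, b, _, hb, _, _, _, rfl⟩
        omega
      · exact ⟨a, b, hlt, hb, ⟨s, hs⟩, hσ, hcont a b s hs hb hab, rfl⟩
    omega
  -- main induction
  have main : ∀ d a s x, w.length - a ≤ d → BInv w n a s x →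
      ∃ γ : CMComputation C, γ.states 0 = s ∧ γ.chans 0 = x ∧ γ.states γ.len = sF ∧
        γ.maxChan ≤ n := by
    intro d
    induction d with
    | zero => intro a s x hd hI; have := hI.hb; omega
    | succ d ih =>
      intro a s x hd hI
      by_cases hsf : s = sF
      · refine ⟨⟨0, fun _ => s, fun _ => x, fun _ => CMLabel.eps, by simp⟩, rfl, rfl, hsf, ?_⟩
        unfold CMComputation.maxChan
        simpa using hI.hx
      obtain ⟨l, s', htr, ⟨b, hb, hbl, hbt⟩, ⟨a', ha', has', hat'⟩⟩ := hst a s hI.st hsf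
      have hbe : b = a + n + 1 := hsm.inj hb hI.hb (by rw [hbt, hI.ht])
      subst hbe
      obtain ⟨b', hb', hσ', hbt'⟩ := hend a' s' has'
      obtain ⟨hab', hbn'⟩ := hsize a' b' s' has' hb' hσ' hbt'
      have haa' : a < a' := hsm.lt_of (symAt_lt hI.st) (by linarith)
      have hP := hpol a (a + n + 1) s l hI.st hbl (by omega) hbt
      -- rigidity
      have R : (∀ i < n, ∃ σ, hasAt w σ (tAt w (a + 1 + i) + 2)) →
          b' = a' + n + 1 ∧ ∀ i ≤ n, tAt w (a' + i) = tAt w (a + i) + 2 := by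
        intro h
        refine rigid hsm hI.hb hb' hab' hbn' hat' hbt hbt' ?_
        intro i hi
        obtain ⟨σ, j, hj, _, hjt⟩ := h i hi
        exact ⟨j, hj, hjt⟩
      -- finishing
      have Fin : ∀ x' : List M, CMStep C (s, x) l (s', x') → x'.length ≤ n →
          (∀ i < n, hasAt w ((x'[i]?).elim CMSym.hash CMSym.msg) (tAt w (a + 1 + i) + 2)) →
          ∃ γ : CMComputation C, γ.states 0 = s ∧ γ.chans 0 = x ∧ γ.states γ.len = sF ∧
            γ.maxChan ≤ n := by
        intro x' hstep hx' hcp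
        obtain ⟨r1, r2⟩ := R (fun i hi => ⟨_, hcp i hi⟩)
        refine cons_comp C sF n hstep hI.hx (ih a' s' x' (by omega)
          ⟨has', by omega, by rw [← r1, hbt'], hx', ?_⟩)
        intro i hi
        obtain ⟨j, hj, hjs, hjt⟩ := hcp i hi
        have := r2 (i + 1) (by omega)
        have hje : j = a' + 1 + i := by
          apply hsm.inj hj (by omega)
          rw [hjt, show a' + 1 + i = a' + (i + 1) by omega, this,
            show a + 1 + i = a + (i + 1) by omega]
        rw [← hje, hjs]
      -- no insertion
      have NoIns : (∀ i < n, ∃ σ, hasAt w σ (tAt w (a + 1 + i) + 2)) →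
          ∀ k, k < w.length → blockLastTime w a (a + n + 1) + 2 < tAt w k →
            tAt w k < tAt w a + 3 → False := by
        intro h k hk h1 h2
        obtain ⟨r1, r2⟩ := R h
        have hbl : blockLastTime w a (a + n + 1) = tAt w (a + n) := by
          unfold blockLastTime
          split_ifs with hh
          · rw [show n = 0 by omega]; rfl
          · rfl
        rw [hbl, ← r2 n le_rfl] at h1
        have k1 := hsm.lt_of (by omega) h1
        have k2 := hsm.lt_of (j := b') hk (by linarith)
        omega
      have hcopyAll : (∀ i σ, a < i → i < a + n + 1 → symAt w i = some σ →
            hasAt w σ (tAt w i + 2)) →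
          ∀ i < n, hasAt w ((x[i]?).elim CMSym.hash CMSym.msg) (tAt w (a + 1 + i) + 2) :=
        fun h i hi => h _ _ (by omega) (by omega) (hI.cont i hi)
      cases l with
      | eps =>
        obtain ⟨p1, p2⟩ := hP
        have hx0 : x = [] := by
          cases x with
          | nil => rfl
          | cons m x =>
            have := hI.hx
            simp only [List.length_cons] at this
            have h1 := hI.cont 0 (by omega)
            rw [p1 _ (by omega) (by omega)] at h1
            simp at h1
        subst hx0
        refine Fin [] (CMStep.eps htr) (by simp) ?_
        intro i hi
        exact p2 _ (by omega) (by omega)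
      | send m =>
        obtain ⟨p1, p2⟩ := hP
        by_cases hh : ∃ j, a < j ∧ j < a + n + 1 ∧ symAt w j = some CMSym.hash
        · obtain ⟨j, j1, j2, j3, j4, j5, j6⟩ := p1 hh
          obtain ⟨i₀, rfl⟩ : ∃ i₀, j = a + 1 + i₀ := ⟨j - a - 1, by omega⟩
          have hge : x.length ≤ i₀ := by
            by_contra hc
            rw [hI.cont i₀ (by omega), List.getElem?_eq_getElem (by omega)] at j3
            simp at j3
          have hle : i₀ ≤ x.length := by
            by_contra hc
            apply j4 (a + 1 + x.length) (by omega) (by omega)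
            rw [hI.cont _ (by omega)]
            simp
          have he : i₀ = x.length := by omega
          subst he
          refine Fin (x ++ [m]) (CMStep.send htr) (by simp; omega) ?_
          intro i hi
          rcases lt_trichotomy i x.length with h | h | h
          · rw [List.getElem?_append_left h]
            exact j6 _ _ (by omega) (by omega) (by omega) (hI.cont i hi)
          · subst h
            simpa using j5
          · rw [List.getElem?_eq_none (by simp; omega)]
            have := hI.cont i hi
            rw [List.getElem?_eq_none (by omega)] at this
            exact j6 _ _ (by omega) (by omega) (by omega) this
        · push Not at hh
          obtain ⟨q1, k, k1, k2, k3, k4⟩ := p2 hh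
          exact (NoIns (fun i hi => ⟨_, hcopyAll q1 i hi⟩) k k1 k3 k4).elim
      | recv m =>
        obtain ⟨p1, p2⟩ := hP
        by_cases hh : a + 1 < a + n + 1 ∧ symAt w (a + 1) = some (CMSym.msg m)
        · obtain ⟨q1, q2⟩ := p1 hh.1 hh.2
          have hn0 : 0 < n := by omega
          have h0 := hI.cont 0 hn0
          have hl := hI.hx
          cases x with
          | nil => rw [Nat.add_zero, hh.2] at h0; simp at h0
          | cons m' x =>
            rw [Nat.add_zero, hh.2] at h0
            simp at h0
            subst h0
            simp only [List.length_cons] at hl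
            refine Fin x (CMStep.recv htr) (by omega) ?_
            intro i hi
            by_cases hi' : i + 1 < n
            · have := q1 (a + 1 + (i + 1)) _ (by omega) (by omega) (hI.cont (i + 1) hi')
              rw [show a + 1 + (i + 1) - 1 = a + 1 + i by omega] at this
              simpa using this
            · rw [List.getElem?_eq_none (by omega)]
              rw [show a + n + 1 - 1 = a + 1 + i by omega] at q2
              exact q2
        · obtain ⟨q1, k, k1, k2, k3, k4⟩ := p2 hh
          exact (NoIns (fun i hi => ⟨_, hcopyAll q1 i hi⟩) k k1 k3 k4).elim
  -- initial block
  obtain ⟨l, s1, rest, hmap⟩ := hpre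
  have hsym : ∀ i, symAt w i = (w.map Prod.fst)[i]? := by
    intro i; simp [symAt]
  have s0 : symAt w 0 = some (CMSym.state C.init) := by rw [hsym, hmap]; rfl
  have sh : ∀ i < n, symAt w (0 + 1 + i) = some CMSym.hash := by
    intro i hi
    rw [hsym, hmap, show 0 + 1 + i = i + 1 by omega, List.getElem?_cons_succ,
      List.getElem?_append_left (by simpa using hi)]
    simp [hi]
  have sl : symAt w (n + 1) = some (CMSym.lab l) := by
    rw [hsym, hmap, List.getElem?_cons_succ, List.getElem?_append_right (by simp)]
    simp
  obtain ⟨b, hb, ⟨σ, hσ, hσ'⟩, hbt⟩ := hend 0 _ s0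
  have hb1 : n + 1 ≤ b := by
    by_contra hc
    rcases Nat.eq_zero_or_pos b with h | h
    · subst h; linarith
    · have := sh (b - 1) (by omega)
      rw [show 0 + 1 + (b - 1) = b by omega, hσ] at this
      injection this with this
      subst this
      exact hσ'
  have hb2 : b ≤ n + 1 := by
    by_contra hc
    obtain ⟨τ, h1, h2⟩ := hcont 0 b _ s0 hb hbt (n + 1) (by omega) (by omega)
    rw [sl] at h1
    injection h1 with h1
    subst h1
    exact h2
  have hbe : b = 0 + n + 1 := by omega
  obtain ⟨γ, g1, g2, g3, g4⟩ := main _ 0 C.init [] le_rfl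
    ⟨s0, by omega, by rw [← hbe, hbt], by simp, fun i hi => by simpa using sh i hi⟩
  exact ⟨γ, ⟨g1, g2, g3⟩, g4⟩
end
end
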